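/- arXiv:2506.21717 — 2 statements merged into one kernel-verified Lean document; each statement's English description precedes it below -/
import Mathlib

section
/- Let K be a field of characteristic different from 2, n ≥ 1 an integer with I^{n+1}K(√-1) = 0, and φ a torsion quadratic form over K belonging to I^n K. Then for every a ∈ K× there exists a finite 2-extension L/K such that φ_L is hyperbolic and a ∈ N_{L/K}(L×); in particular Hyp₂(φ) = K×. -/
open scoped TensorProduct

/-- A (finite-dimensional) quadratic form over the field `K`, bundled with its
underlying vector space. -/
structure QF (K : Type) [Field K] where
  V : Type
  [iAG : AddCommGroup V]
  [iM : Module K V]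
  [iFD : FiniteDimensional K V]
  q : QuadraticForm K V

namespace QF

variable {K : Type} [Field K]

instance (φ : QF K) : AddCommGroup φ.V := φ.iAG
instance (φ : QF K) : Module K φ.V := φ.iM
instance (φ : QF K) : FiniteDimensional K φ.V := φ.iFD

/-- dimension of a quadratic form -/
noncomputable def dim (φ : QF K) : ℕ := Module.finrank K φ.V

/-- isometry of quadratic forms -/
def Equiv (φ ψ : QF K) : Prop := QuadraticMap.Equivalent φ.q ψ.q

/-- nondegeneracy of a quadratic form (via its polar bilinear form) -/
def Nondeg (φ : QF K) : Prop := (QuadraticMap.polarBilin φ.q).Nondegenerate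

/-- scaling a quadratic form by a scalar -/
def smul (a : K) (φ : QF K) : QF K := { V := φ.V, q := a • φ.q }

/-- orthogonal sum of quadratic forms -/
def add (φ ψ : QF K) : QF K := { V := φ.V × ψ.V, q := φ.q.prod ψ.q }

/-- the zero-dimensional quadratic form -/
noncomputable def zero : QF K := { V := Fin 0 → K, q := QuadraticMap.weightedSumSquares K (fun i : Fin 0 => (1 : K)) }

/-- the form `⟨1⟩` -/
noncomputable def one : QF K := { V := Fin 1 → K, q := QuadraticMap.weightedSumSquares K (fun _ : Fin 1 => (1 : K)) }

/-- the binary form `⟨1, -a⟩ = ⟪a⟫` -/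
noncomputable def bin (a : K) : QF K :=
  { V := Fin 2 → K, q := QuadraticMap.weightedSumSquares K ![(1 : K), -a] }

/-- tensor product of quadratic forms -/
noncomputable def tmul [Invertible (2 : K)] (φ ψ : QF K) : QF K :=
  { V := φ.V ⊗[K] ψ.V, q := QuadraticForm.tmul φ.q ψ.q }

/-- `m` copies of the hyperbolic plane `⟨1, -1⟩` -/
noncomputable def hyperbolics : ℕ → QF K
  | 0 => zero
  | m + 1 => add (bin 1) (hyperbolics m)

/-- a form is hyperbolic if it is isometric to a sum of hyperbolic planes -/
def IsHyperbolic (φ : QF K) : Prop := ∃ m : ℕ, φ.Equiv (hyperbolics m)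

/-- anisotropy -/
def Anisotropic (φ : QF K) : Prop := φ.q.Anisotropic

/-- the Witt index -/
noncomputable def wittIndex (φ : QF K) : ℕ :=
  sSup {m : ℕ | ∃ ψ : QF K, φ.Equiv (add (hyperbolics m) ψ)}

/-- a form is split if its anisotropic part has dimension at most one -/
def IsSplit (φ : QF K) : Prop :=
  ∃ (m : ℕ) (ψ : QF K), ψ.Anisotropic ∧ ψ.dim ≤ 1 ∧ φ.Equiv (add (hyperbolics m) ψ)

/-- `n`-fold orthogonal sum of a fixed form -/
noncomputable def nsmul : ℕ → QF K → QF K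
  | 0, _ => zero
  | n + 1, φ => add φ (nsmul n φ)

/-- orthogonal sum of a list of forms -/
noncomputable def sumList : List (QF K) → QF K
  | [] => zero
  | φ :: l => add φ (sumList l)

/-- the Pfister form `⟨⟨a₁, …, aₙ⟩⟩` -/
noncomputable def pfister [Invertible (2 : K)] : List K → QF K
  | [] => one
  | a :: l => tmul (bin a) (pfister l)

/-- Witt equivalence of quadratic forms -/
def WittEquiv (φ ψ : QF K) : Prop := IsHyperbolic (add φ (smul (-1) ψ))

/-- membership in the `n`-th power of the fundamental ideal: Witt equivalence
to an orthogonal sum of scaled `n`-fold Pfister forms -/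
def InFundPow [Invertible (2 : K)] (n : ℕ) (φ : QF K) : Prop :=
  ∃ (r : ℕ) (c : Fin r → K) (l : Fin r → (Fin n → K)),
    (∀ i, c i ≠ 0) ∧
    WittEquiv φ (sumList ((List.finRange r).map fun i => smul (c i) (pfister (List.ofFn (l i)))))

/-- the group of similarity factors `G(φ) = {a ∈ K× : aφ ≅ φ}`, as a set -/
def G (φ : QF K) : Set K := {a | a ≠ 0 ∧ (smul a φ).Equiv φ}

/-- similarity factors of a family of forms -/
def GT {r : ℕ} (φ : Fin r → QF K) : Set K := ⋂ i, G (φ i)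

end QF

/-- a bundled field extension of `K` -/
structure FieldExt (K : Type) [Field K] where
  carrier : Type
  [iF : Field carrier]
  [iA : Algebra K carrier]

attribute [instance] FieldExt.iF FieldExt.iA

namespace QF

variable {K : Type} [Field K]

/-- base change of a quadratic form along a field extension -/
noncomputable def baseChange [Invertible (2 : K)] (L : Type) [Field L] [Algebra K L]
    (φ : QF K) : QF L :=
  { V := L ⊗[K] φ.V, q := QuadraticForm.baseChange L φ.q }

end QF

/-- the set of nonzero norms of a finite field extension -/
def normSet (K : Type) [Field K] (L : Type) [Field L] [Algebra K L] : Set K :=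
  {a | ∃ x : L, x ≠ 0 ∧ Algebra.norm K x = a}

/-- a finite `2`-extension: a tower of quadratic extensions -/
def IsTwoExtension (K : Type) [Field K] (L : Type) [Field L] [Algebra K L] : Prop :=
  FiniteDimensional K L ∧
    ∃ (n : ℕ) (F : Fin (n + 1) → IntermediateField K L),
      F 0 = ⊥ ∧ F (Fin.last n) = ⊤ ∧
        ∀ i : Fin n, F i.castSucc ≤ F i.succ ∧
          IntermediateField.relfinrank (F i.castSucc) (F i.succ) = 2

/-- a multiquadratic extension: Galois with elementary abelian 2-group -/
def IsMultiquadratic (K : Type) [Field K] (L : Type) [Field L] [Algebra K L] : Prop :=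
  FiniteDimensional K L ∧ IsGalois K L ∧ ∀ σ : L ≃ₐ[K] L, σ * σ = 1

namespace QF

variable {K : Type} [Field K] [Invertible (2 : K)]

/-- generating set for `Hyp(φ)`: norms from finite extensions splitting `φ` -/
def hypSet (φ : QF K) : Set K :=
  {a | ∃ L : FieldExt K, FiniteDimensional K L.carrier ∧
    IsHyperbolic (baseChange L.carrier φ) ∧ a ∈ normSet K L.carrier}

/-- the subgroup `Hyp(φ)` generated by norms of finite extensions splitting `φ` -/
def Hyp (φ : QF K) : Submonoid K := Submonoid.closure (hypSet φ)

/-- generating set for `Hyp₂(φ)`: norms from finite 2-extensions splitting `φ` -/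
def hypSet2 (φ : QF K) : Set K :=
  {a | ∃ L : FieldExt K, IsTwoExtension K L.carrier ∧
    IsHyperbolic (baseChange L.carrier φ) ∧ a ∈ normSet K L.carrier}

/-- the subgroup `Hyp₂(φ)` -/
def Hyp2 (φ : QF K) : Submonoid K := Submonoid.closure (hypSet2 φ)

/-- `H(φ) = K×² · Hyp(φ)` -/
def Hgrp (φ : QF K) : Set K :=
  {x | ∃ s : K, s ≠ 0 ∧ ∃ h ∈ Hyp φ, x = s ^ 2 * h}

/-- `K×² · Hyp₂(φ)` -/
def H2grp (φ : QF K) : Set K :=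
  {x | ∃ s : K, s ≠ 0 ∧ ∃ h ∈ Hyp2 φ, x = s ^ 2 * h}

/-- the splitting pattern: the set of Witt indices over all field extensions -/
def Sp (φ : QF K) : Set ℕ :=
  {m | ∃ L : FieldExt K, m = wittIndex (baseChange L.carrier φ)}

end QF

namespace QF

variable {K : Type} [Field K] [Invertible (2 : K)]

/-- norms from finite extensions splitting all forms in a family -/
def hypSetT {r : ℕ} (φ : Fin r → QF K) : Set K :=
  {a | ∃ L : FieldExt K, FiniteDimensional K L.carrier ∧
    (∀ i, IsHyperbolic (baseChange L.carrier (φ i))) ∧ a ∈ normSet K L.carrier}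

/-- the subgroup `Hyp` of a family of forms -/
def HypT {r : ℕ} (φ : Fin r → QF K) : Submonoid K := Submonoid.closure (hypSetT φ)

/-- norms from finite 2-extensions splitting all forms in a family -/
def hypSet2T {r : ℕ} (φ : Fin r → QF K) : Set K :=
  {a | ∃ L : FieldExt K, IsTwoExtension K L.carrier ∧
    (∀ i, IsHyperbolic (baseChange L.carrier (φ i))) ∧ a ∈ normSet K L.carrier}

/-- the subgroup `Hyp₂` of a family of forms -/
def Hyp2T {r : ℕ} (φ : Fin r → QF K) : Submonoid K := Submonoid.closure (hypSet2T φ)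

/-- `H` of a family of forms: `K×² · Hyp` -/
def HgrpT {r : ℕ} (φ : Fin r → QF K) : Set K :=
  {x | ∃ s : K, s ≠ 0 ∧ ∃ h ∈ HypT φ, x = s ^ 2 * h}

end QF

/-- the map `O → O'` between valuation rings induced by a compatible field embedding -/
def liftVSHom {K M : Type} [Field K] [Field M] [Algebra K M]
    (O : ValuationSubring K) (OM : ValuationSubring M)
    (hc : ∀ x : K, x ∈ O ↔ algebraMap K M x ∈ OM) : O →+* OM where
  toFun x := ⟨algebraMap K M x, (hc x).1 x.2⟩
  map_one' := by ext; simp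
  map_mul' x y := by ext; simp
  map_zero' := by ext; simp
  map_add' x y := by ext; simp

/-- `v` is unramified in the subextension `E` of `M/K`: the value group does not grow
and the residue field extension is separable (every residue is a simple root of a
separable polynomial over the residue field of `O`) -/
def UnramifiedIn {K M : Type} [Field K] [Field M] [Algebra K M]
    (O : ValuationSubring K) (OM : ValuationSubring M)
    (hc : ∀ x : K, x ∈ O ↔ algebraMap K M x ∈ OM) (E : IntermediateField K M) : Prop :=
  (∀ y : M, y ∈ E → y ≠ 0 →
      ∃ x : K, x ≠ 0 ∧ OM.valuation y = OM.valuation (algebraMap K M x)) ∧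
  (∀ y : M, y ∈ E → ∀ hy : y ∈ OM, ∃ p : Polynomial O, p.Monic ∧
      (p.map (IsLocalRing.residue O)).Separable ∧
      Polynomial.eval (⟨y, hy⟩ : OM) (p.map (liftVSHom O OM hc)) ∈ IsLocalRing.maximalIdeal OM)

/-- the value group of a valuation, as a subgroup of the units of the codomain -/
def unitsValueGroup {L Γ : Type} [Field L] [LinearOrderedCommGroupWithZero Γ]
    (w : Valuation L Γ) : Subgroup Γˣ :=
  (Units.map w.toMonoidWithZeroHom.toMonoidHom).range

/-- iterated Laurent series field, bundled with its field structure -/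
noncomputable def IterLaurentP (k : Type) [Field k] : ℕ → Σ' (T : Type), Field T :=
  fun n => Nat.rec ⟨k, ‹Field k›⟩
    (fun _ p => by letI := p.2; exact ⟨LaurentSeries p.1, inferInstance⟩) n

/-- iterated Laurent series field `k((t₁))…((tₙ))` -/
@[reducible] noncomputable def IterLaurent (k : Type) [Field k] (n : ℕ) : Type :=
  (IterLaurentP k n).1

noncomputable instance (k : Type) [Field k] (n : ℕ) : Field (IterLaurent k n) :=
  (IterLaurentP k n).2

/-- the embedding of the coefficient field in the iterated Laurent series field -/
noncomputable def iterC (k : Type) [Field k] : ∀ n, k →+* IterLaurent k n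
  | 0 => RingHom.id k
  | n + 1 => (HahnSeries.C : IterLaurent k n →+* LaurentSeries (IterLaurent k n)).comp (iterC k n)

/-- the variables `t₁, …, tₙ` of the iterated Laurent series field -/
noncomputable def tvar (k : Type) [Field k] : ∀ n, Fin n → IterLaurent k n
  | 0 => fun i => i.elim0
  | n + 1 => fun i =>
      (Fin.lastCases (motive := fun _ => LaurentSeries (IterLaurent k n))
        (HahnSeries.single 1 1) (fun j => HahnSeries.C (tvar k n j)) i : IterLaurent k (n + 1))

set_option linter.unusedSectionVars false
set_option linter.unusedVariables false
set_option linter.unusedSimpArgs false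
namespace WT
open Module

section lin
variable {F : Type} [Field F] {V V' : Type} [AddCommGroup V] [Module F V] [FiniteDimensional F V]
  [AddCommGroup V'] [Module F V'] [FiniteDimensional F V']
  {Q : QuadraticForm F V} {Q' : QuadraticForm F V'}

/-- nondegeneracy, elementwise -/
def ND (Q : QuadraticForm F V) : Prop := ∀ x : V, (∀ y, QuadraticMap.polar Q x y = 0) → x = 0

lemma ND.nondeg (h : ND Q) : (QuadraticMap.polarBilin Q).Nondegenerate := by
  constructor
  · intro x hx
    exact h x (fun y => hx y)
  · intro x hx
    refine h x (fun y => ?_)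
    rw [QuadraticMap.polar_comm]; exact hx y

/-- metabolic -/
def MetF (Q : QuadraticForm F V) : Prop := ∃ N : Submodule F V, (∀ x ∈ N, Q x = 0) ∧
  2 * finrank F N = finrank F V

lemma polar_zero_of_iso {N : Submodule F V} (hN : ∀ x ∈ N, Q x = 0)
    {x y} (hx : x ∈ N) (hy : y ∈ N) : QuadraticMap.polar Q x y = 0 := by
  simp [QuadraticMap.polar, hN _ hx, hN _ hy, hN _ (N.add_mem hx hy)]

lemma finrank_le_of_orth (h : ND Q) (N M : Submodule F V)
    (hNM : ∀ x ∈ N, ∀ y ∈ M, QuadraticMap.polar Q x y = 0) :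
    finrank F N + finrank F M ≤ finrank F V := by
  have h1 := LinearMap.BilinForm.finrank_orthogonal h.nondeg N
  have h2 : M ≤ LinearMap.BilinForm.orthogonal (QuadraticMap.polarBilin Q) N := by
    intro y hy x hx
    exact hNM x hx y hy
  have h3 := Submodule.finrank_mono h2
  have h4 := Submodule.finrank_le N
  rw [h1] at h3
  omega

lemma polar_prod' (x y : V × V') : QuadraticMap.polar (Q.prod Q') x y =
    QuadraticMap.polar Q x.1 y.1 + QuadraticMap.polar Q' x.2 y.2 := by
  exact QuadraticMap.polar_prod _ _ _ _

lemma ND.prod (h : ND Q) (h' : ND Q') : ND (Q.prod Q') := by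
  intro x hx
  have h1 : x.1 = 0 := h _ fun y => by
    have := hx (y, 0)
    rw [polar_prod'] at this
    simpa using this
  have h2 : x.2 = 0 := h' _ fun y => by
    have := hx (0, y)
    rw [polar_prod'] at this
    simpa using this
  exact Prod.ext h1 h2

lemma ND.of_prod (h : ND (Q.prod Q')) : ND Q ∧ ND Q' := by
  constructor
  · intro x hx
    have := h (x, 0) (fun y => by rw [polar_prod']; simp [hx])
    exact congrArg Prod.fst this
  · intro x hx
    have := h (0, x) (fun y => by rw [polar_prod']; simp [hx])
    exact congrArg Prod.snd this

lemma ND.congr (e : Q.Equivalent Q') (h : ND Q) : ND Q' := by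
  obtain ⟨e⟩ := e
  intro x hx
  have : e.symm x = 0 := h _ fun y => by
    have := hx (e y)
    simp only [QuadraticMap.polar] at this ⊢
    rw [← this, ← e.map_app, ← e.map_app, ← e.map_app, map_add]
    simp [QuadraticMap.IsometryEquiv.apply_symm_apply]
  rw [← e.apply_symm_apply x, this, map_zero]

lemma MetF.congr (e : Q.Equivalent Q') (h : MetF Q) : MetF Q' := by
  obtain ⟨e⟩ := e
  obtain ⟨N, h1, h2⟩ := h
  refine ⟨N.map e.toLinearEquiv.toLinearMap, ?_, ?_⟩
  · rintro _ ⟨x, hx, rfl⟩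
    exact (e.map_app x).trans (h1 x hx)
  · rw [LinearEquiv.finrank_map_eq, h2]
    exact e.toLinearEquiv.finrank_eq

lemma finrank_sprod (N : Submodule F V) (N' : Submodule F V') :
    finrank F (N.prod N') = finrank F N + finrank F N' := by
  have : N.prod N' = LinearMap.range (N.subtype.prodMap N'.subtype) := by
    rw [LinearMap.range_prodMap]; simp
  rw [this, LinearMap.finrank_range_of_inj, Module.finrank_prod]
  exact Prod.map_injective.2 ⟨N.injective_subtype, N'.injective_subtype⟩

lemma MetF.prod (h : MetF Q) (h' : MetF Q') : MetF (Q.prod Q') := by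
  obtain ⟨N, h1, h2⟩ := h
  obtain ⟨N', h1', h2'⟩ := h'
  refine ⟨N.prod N', ?_, ?_⟩
  · rintro x ⟨hx, hy⟩
    rw [QuadraticMap.prod_apply, h1 _ hx, h1' _ hy, add_zero]
  · rw [Module.finrank_prod, ← h2, ← h2', finrank_sprod]
    ring

lemma MetF.cancel (hφ : ND Q) (hψ : ND Q') (h : MetF (Q.prod Q')) (h' : MetF Q') :
    MetF Q := by
  obtain ⟨L, h1, h2⟩ := h
  obtain ⟨L2, h1', h2'⟩ := h'
  let P : Submodule F (V × V') := (⊤ : Submodule F V).prod L2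
  let Z : Submodule F (V × V') := (⊥ : Submodule F V).prod L2
  let f : V × V' →ₗ[F] V := LinearMap.fst F V V'
  let L1 := (L ⊓ P : Submodule F (V × V')).map f
  have hiso : ∀ x ∈ L1, Q x = 0 := by
    rintro _ ⟨x, ⟨hx, -, hy⟩, rfl⟩
    have := h1 x hx
    rw [QuadraticMap.prod_apply, h1' _ hy, add_zero] at this
    exact this
  refine ⟨L1, hiso, ?_⟩
  have e0 : 2 * finrank F L1 ≤ finrank F V := by
    have := finrank_le_of_orth hφ L1 L1 (fun x hx y hy => polar_zero_of_iso hiso hx hy)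
    omega
  have e1 := Submodule.finrank_sup_add_finrank_inf_eq L P
  have e2 : finrank F P = finrank F V + finrank F L2 := by
    rw [finrank_sprod, finrank_top]
  have e3 : finrank F ↥(L ⊓ P) ≤ finrank F L1 + finrank F ↥(L ⊓ Z) := by
    let g := f.domRestrict (L ⊓ P)
    have k1 := LinearMap.finrank_range_add_finrank_ker g
    have k2 : LinearMap.range g = L1 := LinearMap.range_domRestrict _ _
    have k3 : (LinearMap.ker g).map (L ⊓ P).subtype ≤ L ⊓ Z := by
      rintro _ ⟨⟨x, hx⟩, hk, rfl⟩
      exact ⟨hx.1, hk, hx.2.2⟩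
    have k4 := Submodule.finrank_mono k3
    rw [Submodule.finrank_map_subtype_eq] at k4
    rw [k2] at k1
    omega
  have e4 : finrank F ↥(L ⊔ P) + finrank F ↥(L ⊓ Z) ≤ finrank F V + finrank F V' := by
    rw [← Module.finrank_prod (R := F) (M := V) (M' := V')]
    refine finrank_le_of_orth (hφ.prod hψ) _ _ ?_
    rintro x hx y ⟨hyL, hy1, hy2⟩
    obtain ⟨u, hu, v, hv, rfl⟩ := Submodule.mem_sup.1 hx
    rw [QuadraticMap.polar_add_left, polar_zero_of_iso h1 hu hyL, zero_add, polar_prod']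
    have : y.1 = 0 := hy1
    rw [this, polar_zero_of_iso h1' hv.2 hy2]
    simp
  rw [Module.finrank_prod] at h2
  omega

lemma MetF.iso_of_lt (h : MetF (Q.prod Q')) (hlt : finrank F V' < finrank F V) :
    ∃ x ≠ 0, Q x = 0 := by
  obtain ⟨L, h1, h2⟩ := h
  rw [Module.finrank_prod] at h2
  let g : L →ₗ[F] V' := (LinearMap.snd F V V').comp L.subtype
  have : ¬ Function.Injective g := fun hi => by
    have := LinearMap.finrank_le_finrank_of_injective hi
    omega
  rw [← LinearMap.ker_eq_bot, Submodule.eq_bot_iff] at this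
  push Not at this
  obtain ⟨⟨x, hx⟩, hk, h0⟩ := this
  have hk' : x.2 = 0 := hk
  have hq := h1 x hx
  rw [QuadraticMap.prod_apply, hk', map_zero, add_zero] at hq
  refine ⟨x.1, fun h => h0 ?_, hq⟩
  exact Subtype.ext (Prod.ext h hk')

lemma MetF.graph (e : Q.Equivalent Q') : MetF (Q.prod (-Q')) := by
  obtain ⟨e⟩ := e
  refine ⟨LinearMap.range (LinearMap.prod LinearMap.id e.toLinearEquiv.toLinearMap), ?_, ?_⟩
  · rintro _ ⟨x, rfl⟩
    have : Q x + - Q' (e x) = 0 := by rw [e.map_app]; ring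
    exact this
  · rw [LinearMap.finrank_range_of_inj, Module.finrank_prod]
    · have : finrank F V = finrank F V' := e.toLinearEquiv.finrank_eq
      omega
    · intro x y h
      exact congrArg Prod.fst h
end lin
end WT

set_option linter.unusedSectionVars false
set_option linter.unusedVariables false
set_option linter.unusedSimpArgs false
namespace WT
open Module

section lists
variable {F : Type} [Field F]

/-- one-dimensional form -/
noncomputable def un (a : F) : QF F := { V := F, q := a • QuadraticMap.sq }

/-- diagonal form -/
noncomputable def dq : List Fˣ → QF F
  | [] => QF.zero
  | a :: m => QF.add (un (a : F)) (dq m)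

lemma un_apply (a : F) (x : F) : (un a).q x = a * (x * x) := rfl

lemma eqv_refl (φ : QF F) : φ.Equiv φ := QuadraticMap.Equivalent.refl _
lemma eqv_symm {φ ψ : QF F} (h : φ.Equiv ψ) : ψ.Equiv φ := QuadraticMap.Equivalent.symm h
lemma eqv_trans {φ ψ χ : QF F} (h : φ.Equiv ψ) (h' : ψ.Equiv χ) : φ.Equiv χ :=
  QuadraticMap.Equivalent.trans h h'
lemma eqv_add {φ ψ φ' ψ' : QF F} (h : φ.Equiv φ') (h' : ψ.Equiv ψ') :
    (φ.add ψ).Equiv (φ'.add ψ') := QuadraticMap.Equivalent.prod h h'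
lemma eqv_add_comm (φ ψ : QF F) : (φ.add ψ).Equiv (ψ.add φ) :=
  ⟨QuadraticMap.IsometryEquiv.prodComm _ _⟩
lemma eqv_add_assoc (φ ψ χ : QF F) : ((φ.add ψ).add χ).Equiv (φ.add (ψ.add χ)) :=
  ⟨⟨LinearEquiv.prodAssoc F φ.V ψ.V χ.V, fun x => (add_assoc (φ.q x.1.1) (ψ.q x.1.2) (χ.q x.2)).symm⟩⟩

lemma zero_q (x : Fin 0 → F) :
    (QuadraticMap.weightedSumSquares F (fun i : Fin 0 => (1 : F))) x = 0 := by
  simp [QuadraticMap.weightedSumSquares_apply]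

lemma eqv_zero_add (φ : QF F) : (QF.zero.add φ).Equiv φ := by
  refine ⟨⟨(LinearEquiv.uniqueProd : ((Fin 0 → F) × φ.V) ≃ₗ[F] φ.V), ?_⟩⟩
  rintro ⟨x, y⟩
  exact (((congrArg (· + φ.q y) (zero_q (F := F) x)).trans (zero_add _))).symm

lemma eqv_add_zero (φ : QF F) : (φ.add QF.zero).Equiv φ :=
  eqv_trans (eqv_add_comm _ _) (eqv_zero_add _)

lemma eqv_smul {φ ψ : QF F} (a : F) (h : φ.Equiv ψ) : (φ.smul a).Equiv (ψ.smul a) := by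
  obtain ⟨e⟩ := h
  exact ⟨⟨e.toLinearEquiv, fun x => congrArg (a * ·) (e.map_app x)⟩⟩

lemma eqv_smul_add (a : F) (φ ψ : QF F) : ((φ.add ψ).smul a).Equiv ((φ.smul a).add (ψ.smul a)) :=
  ⟨⟨LinearEquiv.refl F (φ.V × ψ.V), fun x => (mul_add a (φ.q x.1) (ψ.q x.2)).symm⟩⟩

lemma eqv_smul_zero (a : F) : ((QF.zero : QF F).smul a).Equiv QF.zero := by
  refine ⟨⟨LinearEquiv.refl F (Fin 0 → F), fun x => ?_⟩⟩
  exact (zero_q (F := F) x).trans ((congrArg (a * ·) (zero_q (F := F) x)).trans (mul_zero a)).symm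

lemma eqv_smul_un (a b : F) : ((un b).smul a).Equiv (un (a * b)) :=
  ⟨⟨LinearEquiv.refl F F, fun (x : F) => mul_assoc a b (x * x)⟩⟩

lemma eqv_smul_smul (a b : F) (φ : QF F) : ((φ.smul b).smul a).Equiv (φ.smul (a * b)) :=
  ⟨⟨LinearEquiv.refl F φ.V, fun x => mul_assoc a b (φ.q x)⟩⟩

lemma eqv_smul_one (φ : QF F) : (φ.smul 1).Equiv φ :=
  ⟨⟨LinearEquiv.refl F φ.V, fun x => (one_mul (φ.q x)).symm⟩⟩

lemma dq_append (l m : List Fˣ) : (dq (l ++ m)).Equiv ((dq l).add (dq m)) := by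
  induction l with
  | nil => exact eqv_symm (eqv_zero_add _)
  | cons a l ih => exact eqv_trans (eqv_add (eqv_refl _) ih) (eqv_symm (eqv_add_assoc _ _ _))

lemma dq_map (a : Fˣ) (m : List Fˣ) : (dq (m.map (a * ·))).Equiv ((dq m).smul (a : F)) := by
  induction m with
  | nil => exact eqv_symm (eqv_smul_zero _)
  | cons b m ih =>
    refine eqv_trans (eqv_add ?_ ih) (eqv_symm (eqv_smul_add _ _ _))
    exact eqv_symm (eqv_smul_un _ _)

lemma dq_swap (a b : Fˣ) (m : List Fˣ) : (dq (a :: b :: m)).Equiv (dq (b :: a :: m)) :=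
  eqv_trans (eqv_symm (eqv_add_assoc _ _ _)) (eqv_trans (eqv_add (eqv_add_comm _ _) (eqv_refl _))
    (eqv_add_assoc _ _ _))

lemma dq_perm {l m : List Fˣ} (h : l.Perm m) : (dq l).Equiv (dq m) := by
  induction h with
  | nil => exact eqv_refl _
  | cons a _ ih => exact eqv_add (eqv_refl _) ih
  | swap a b l => exact dq_swap _ _ _
  | trans _ _ h1 h2 => exact eqv_trans h1 h2

/-- chain equivalence of diagonal forms -/
inductive Ch : List Fˣ → List Fˣ → Prop
  | refl (m) : Ch m m
  | trans {l m n} : Ch l m → Ch m n → Ch l n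
  | cons (a) {l m} : Ch l m → Ch (a :: l) (a :: m)
  | swap (a b m) : Ch (a :: b :: m) (b :: a :: m)
  | sq (a x m) : Ch (a :: m) (a * (x * x) :: m)
  | bin (a b c : Fˣ) (m) (h : (c : F) = a + b) : Ch (a :: b :: m) (c :: a * b * c :: m)

lemma Ch.map {L : Type} [Field L] (f : F →+* L) {l m : List Fˣ} (h : Ch l m) :
    Ch (l.map (Units.map (f : F →* L))) (m.map (Units.map (f : F →* L))) := by
  induction h with
  | refl m => exact Ch.refl _
  | trans _ _ h1 h2 => exact h1.trans h2
  | cons a _ ih => exact ih.cons _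
  | swap a b m => exact Ch.swap _ _ _
  | sq a x m => simpa using Ch.sq (Units.map (f : F →* L) a) (Units.map (f : F →* L) x) _
  | bin a b c m h =>
    simpa using Ch.bin (Units.map (f : F →* L) a) (Units.map (f : F →* L) b)
      (Units.map (f : F →* L) c) _ (by simp [h])

lemma Ch.length {l m : List Fˣ} (h : Ch l m) : l.length = m.length := by
  induction h <;> simp_all

lemma un_sq (a x : Fˣ) : (un (a : F)).Equiv (un ((a * (x * x) : Fˣ) : F)) := by
  refine ⟨⟨LinearEquiv.smulOfUnit (x⁻¹ : Fˣ), fun (y : F) => ?_⟩⟩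
  show ((a * (x * x) : Fˣ) : F) * (((x⁻¹ : Fˣ) : F) * y * (((x⁻¹ : Fˣ) : F) * y)) = a * (y * y)
  push_cast
  field_simp

lemma un_bin (a b c : Fˣ) (h : (c : F) = a + b) : ((un (a : F)).add (un (b : F))).Equiv
    ((un (c : F)).add (un ((a * b * c : Fˣ) : F))) := by
  refine eqv_symm ?_
  have hc := c.ne_zero
  have hc' : (a : F) + b ≠ 0 := h ▸ hc
  let f : F × F →ₗ[F] F × F := 
    { toFun := fun x => (x.1 - b * x.2, x.1 + a * x.2)
      map_add' := fun x y => by ext <;> simp <;> ring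
      map_smul' := fun r x => by ext <;> simp <;> ring }
  let g : F × F →ₗ[F] F × F := 
    { toFun := fun x => ((a * x.1 + b * x.2) / c, (x.2 - x.1) / c)
      map_add' := fun x y => by ext <;> simp <;> ring
      map_smul' := fun r x => by ext <;> simp <;> ring }
  have hgf : ∀ x, g (f x) = x := by
    rintro ⟨x, y⟩
    apply Prod.ext
    · show (a * (x - b * y) + b * (x + a * y)) / (c : F) = x
      rw [h]; field_simp; ring
    · show ((x + a * y) - (x - b * y)) / (c : F) = y
      rw [h]; field_simp; ring
  have hfg : ∀ x, f (g x) = x := by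
    rintro ⟨x, y⟩
    apply Prod.ext
    · show (a * x + b * y) / (c : F) - b * ((y - x) / c) = x
      rw [h]; field_simp; ring
    · show (a * x + b * y) / (c : F) + a * ((y - x) / c) = y
      rw [h]; field_simp; ring
  let e : (F × F) ≃ₗ[F] (F × F) := LinearEquiv.ofLinearMap f g (LinearMap.ext hfg) (LinearMap.ext hgf)
  refine ⟨⟨e, ?_⟩⟩
  rintro ⟨(x : F), (y : F)⟩
  show (a : F) * ((x - b * y) * (x - b * y)) + b * ((x + a * y) * (x + a * y)) =
    c * (x * x) + ((a * b * c : Fˣ) : F) * (y * y)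
  push_cast
  rw [h]; ring

lemma Ch.eqv {l m : List Fˣ} (h : Ch l m) : (dq l).Equiv (dq m) := by
  induction h with
  | refl m => exact eqv_refl _
  | trans _ _ h1 h2 => exact eqv_trans h1 h2
  | cons a _ ih => exact eqv_add (eqv_refl _) ih
  | swap a b m => exact dq_swap _ _ _
  | sq a x m => exact eqv_add (un_sq a x) (eqv_refl _)
  | bin a b c m h =>
    exact eqv_trans (eqv_symm (eqv_add_assoc _ _ _)) (eqv_trans (eqv_add (un_bin a b c h) (eqv_refl _))
      (eqv_add_assoc _ _ _))

lemma finrank_dq (m : List Fˣ) : finrank F (dq m).V = m.length := by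
  induction m with
  | nil => exact (Module.finrank_fin_fun F : finrank F (Fin 0 → F) = 0)
  | cons a m ih =>
    have : finrank F (F × (dq m).V) = _ := Module.finrank_prod
    rw [ih, Module.finrank_self] at this
    exact this.trans (by simp [add_comm])

lemma ND_un [NeZero (2 : F)] {a : F} (ha : a ≠ 0) : ND (un a).q := by
  intro (x : F) hx
  have : QuadraticMap.polar (fun x : F => a * (x * x)) x 1 = 0 := hx (1 : F)
  simp only [QuadraticMap.polar] at this
  have h2 : a * 2 * x = 0 := by linear_combination this
  have : x = 0 := by simpa [ha, two_ne_zero] using h2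
  exact this

lemma ND_dq [NeZero (2 : F)] (m : List Fˣ) : ND (dq m).q := by
  induction m with
  | nil => exact fun (x : Fin 0 → F) _ => Subsingleton.elim x 0
  | cons a m ih => exact (ND_un a.ne_zero).prod ih

/-- values -/
def D : List Fˣ → F → Prop
  | [], y => y = 0
  | a :: m, y => ∃ s z : F, D m z ∧ y = a * s ^ 2 + z

/-- isotropy -/
def Iso : List Fˣ → Prop
  | [] => False
  | a :: m => Iso m ∨ ∃ s : F, s ≠ 0 ∧ D m (- (a * s ^ 2))

lemma D_iff (m : List Fˣ) (y : F) : D m y ↔ ∃ x, (dq m).q x = y := by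
  induction m generalizing y with
  | nil =>
    constructor
    · rintro rfl
      exact ⟨0, map_zero _⟩
    · rintro ⟨(x : Fin 0 → F), h⟩
      rw [← h]
      show (QuadraticMap.weightedSumSquares F (fun i : Fin 0 => (1 : F))) x = 0
      simp [QuadraticMap.weightedSumSquares_apply]
  | cons a m ih =>
    constructor
    · rintro ⟨s, z, hz, rfl⟩
      obtain ⟨x, rfl⟩ := (ih z).1 hz
      exact ⟨((s, x) : F × (dq m).V), by
        show (a : F) * (s * s) + (dq m).q x = _
        ring⟩
    · rintro ⟨⟨(x : F), y⟩, rfl⟩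
      exact ⟨x, _, (ih _).2 ⟨y, rfl⟩, by
        show (a : F) * (x * x) + (dq m).q y = _
        rw [← pow_two]⟩

lemma Iso_of (m : List Fˣ) (h : ∃ x ≠ 0, (dq m).q x = 0) : Iso m := by
  induction m with
  | nil =>
    obtain ⟨(x : Fin 0 → F), h, -⟩ := h
    exact h (Subsingleton.elim x 0)
  | cons a m ih =>
    obtain ⟨⟨(x : F), y⟩, h0, hx⟩ := h
    have hx' : (a : F) * (x * x) + (dq m).q y = 0 := hx
    by_cases h1 : x = 0
    · left
      refine ih ⟨y, fun h2 => h0 (Prod.ext h1 h2), ?_⟩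
      rw [h1] at hx'
      simpa using hx'
    · right
      refine ⟨x, h1, (D_iff _ _).2 ⟨y, ?_⟩⟩
      linear_combination hx'

/-- metabolic list -/
def Met (m : List Fˣ) : Prop := MetF (dq m).q

lemma Met.congr {l m : List Fˣ} (h : (dq l).Equiv (dq m)) (hl : Met l) : Met m := MetF.congr h hl

lemma Met.append {l m : List Fˣ} (hl : Met l) (hm : Met m) : Met (l ++ m) :=
  MetF.congr (eqv_symm (dq_append l m)) (MetF.prod hl hm)

lemma Met.cancel [NeZero (2 : F)] {l m : List Fˣ} (h : Met (l ++ m)) (hm : Met m) : Met l :=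
  MetF.cancel (ND_dq l) (ND_dq m) (MetF.congr (dq_append l m) h) hm

lemma MetF.smul {φ : QF F} (a : F) (h : MetF φ.q) : MetF (φ.smul a).q := by
  obtain ⟨N, h1, h2⟩ := h
  refine ⟨N, fun x hx => ?_, h2⟩
  show a * φ.q x = 0
  rw [h1 x hx, mul_zero]

lemma Met.map {m : List Fˣ} (hm : Met m) (a : Fˣ) : Met (m.map (a * ·)) :=
  MetF.congr (eqv_symm (dq_map a m)) (MetF.smul _ hm)

lemma Met.even {m : List Fˣ} (hm : Met m) : Even m.length := by
  obtain ⟨N, -, h⟩ := hm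
  rw [finrank_dq] at h
  exact ⟨finrank F N, by omega⟩

lemma Met_nil : Met ([] : List Fˣ) := ⟨⊥, by simp, by rw [finrank_dq]; simp⟩

lemma Met.iso_of_lt {l m : List Fˣ} (h : Met (l ++ m)) (hlt : m.length < l.length) : Iso l :=
  Iso_of _ (MetF.iso_of_lt (MetF.congr (dq_append l m) h) (by rwa [finrank_dq, finrank_dq]))

lemma Met_graph {l m : List Fˣ} (h : (dq l).Equiv (dq m)) : Met (l ++ m.map ((-1) * ·)) := by
  refine MetF.congr (eqv_symm (eqv_trans (dq_append l _) (eqv_add (eqv_refl _) (dq_map (-1) m)))) ?_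
  obtain ⟨N, h1, h2⟩ := MetF.graph h
  refine ⟨N, fun x hx => ?_, h2⟩
  have := h1 x hx
  rw [← this]
  show (dq l).q x.1 + ((-1 : Fˣ) : F) * (dq m).q x.2 = (dq l).q x.1 + - (dq m).q x.2
  simp

end lists
end WT

set_option linter.unusedSectionVars false
set_option linter.unusedVariables false
set_option linter.unusedSimpArgs false
namespace WT
open Module

section wittring
variable {F : Type} [Field F]

/-- class of a list in the group ring -/
noncomputable def cl0 (m : List Fˣ) : MonoidAlgebra ℤ Fˣ :=
  (m.map fun a => MonoidAlgebra.single a (1 : ℤ)).sum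

lemma cl0_append (l m : List Fˣ) : cl0 (l ++ m) = cl0 l + cl0 m := by simp [cl0]

lemma cl0_map (a : Fˣ) (m : List Fˣ) :
    cl0 (m.map (a * ·)) = MonoidAlgebra.single a (1 : ℤ) * cl0 m := by
  induction m with
  | nil => simp [cl0]
  | cons b m ih =>
    have : ∀ (b : Fˣ) (m : List Fˣ), cl0 (b :: m) = MonoidAlgebra.single b (1 : ℤ) + cl0 m := by
      intro b m; simp [cl0]
    rw [List.map_cons, this, this, ih, mul_add, MonoidAlgebra.single_mul_single, mul_one]

open Classical in
lemma cl0_coeff (m : List Fˣ) (g : Fˣ) : (cl0 m).coeff g = m.count g := by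
  induction m with
  | nil => simp [cl0]
  | cons b m ih =>
    have : cl0 (b :: m) = MonoidAlgebra.single b (1 : ℤ) + cl0 m := by
      simp [cl0]
    rw [this, List.count_cons]
    simp [Finsupp.single_apply, ih]
    ring

lemma perm_of_cl0 {l m : List Fˣ} (h : cl0 l = cl0 m) : l.Perm m := by
  classical
  rw [List.perm_iff_count]
  intro g
  have := cl0_coeff l g
  rw [h, cl0_coeff] at this
  exact_mod_cast this.symm

variable (F) in
/-- the ideal of metabolic classes -/
noncomputable def WI : Ideal (MonoidAlgebra ℤ Fˣ) := Ideal.span {x | ∃ m, Met m ∧ x = cl0 m}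

lemma mem_WI {x : MonoidAlgebra ℤ Fˣ} (hx : x ∈ WI F) :
    ∃ l m, Met l ∧ Met m ∧ x = cl0 l - cl0 m := by
  have smul_single : ∀ (a : Fˣ) (n : ℤ) (y : MonoidAlgebra ℤ Fˣ),
      (∃ l m, Met l ∧ Met m ∧ y = cl0 l - cl0 m) →
      ∃ l m, Met l ∧ Met m ∧ MonoidAlgebra.single a n * y = cl0 l - cl0 m := by
    rintro a n _ ⟨l, m, hl, hm, rfl⟩
    induction n using Int.induction_on with
    | zero => exact ⟨[], [], Met_nil, Met_nil, by simp⟩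
    | succ i ih =>
      obtain ⟨l', m', hl', hm', h⟩ := ih
      refine ⟨l' ++ l.map (a * ·), m' ++ m.map (a * ·), hl'.append (hl.map a),
        hm'.append (hm.map a), ?_⟩
      rw [MonoidAlgebra.single_add, add_mul, h, cl0_append, cl0_append, cl0_map, cl0_map]
      ring
    | pred i ih =>
      obtain ⟨l', m', hl', hm', h⟩ := ih
      refine ⟨l' ++ m.map (a * ·), m' ++ l.map (a * ·), hl'.append (hm.map a),
        hm'.append (hl.map a), ?_⟩
      rw [MonoidAlgebra.single_sub, sub_mul, h, cl0_append, cl0_append, cl0_map, cl0_map]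
      ring
  have hadd : ∀ x y : MonoidAlgebra ℤ Fˣ, (∃ l m, Met l ∧ Met m ∧ x = cl0 l - cl0 m) →
      (∃ l m, Met l ∧ Met m ∧ y = cl0 l - cl0 m) →
      ∃ l m, Met l ∧ Met m ∧ x + y = cl0 l - cl0 m := by
    rintro _ _ ⟨l, m, hl, hm, rfl⟩ ⟨l', m', hl', hm', rfl⟩
    refine ⟨l ++ l', m ++ m', hl.append hl', hm.append hm', ?_⟩
    rw [cl0_append, cl0_append]; ring
  refine Submodule.span_induction ?_ ?_ (fun x y _ _ => hadd x y) ?_ hx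
  · rintro _ ⟨m, hm, rfl⟩
    exact ⟨m, [], hm, Met_nil, by simp [cl0]⟩
  · exact ⟨[], [], Met_nil, Met_nil, by simp⟩
  · intro r y _ hy
    rw [smul_eq_mul]
    induction r using MonoidAlgebra.induction_linear with
    | zero => exact ⟨[], [], Met_nil, Met_nil, by simp⟩
    | add f g hf hg => rw [add_mul]; exact hadd _ _ hf hg
    | single a n => exact smul_single a n y hy

lemma cl0_mem [NeZero (2 : F)] {m : List Fˣ} : cl0 m ∈ WI F ↔ Met m := by
  constructor
  · intro h
    obtain ⟨l, l', hl, hl', e⟩ := mem_WI h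
    have : cl0 l = cl0 (m ++ l') := by rw [cl0_append, e]; ring
    exact (hl.congr (dq_perm (perm_of_cl0 this))).cancel hl'
  · intro h
    exact Ideal.subset_span ⟨m, h, rfl⟩

variable (F) in
/-- the Witt ring -/
def W : Type := MonoidAlgebra ℤ Fˣ ⧸ WI F

noncomputable instance : CommRing (W F) := inferInstanceAs (CommRing (MonoidAlgebra ℤ Fˣ ⧸ WI F))

/-- quotient map -/
noncomputable def wmk : MonoidAlgebra ℤ Fˣ →+* W F := Ideal.Quotient.mk (WI F)

open Classical in
/-- class of one-dimensional form -/
noncomputable def br (a : F) : W F :=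
  if h : a = 0 then 0 else wmk (MonoidAlgebra.single (Units.mk0 a h) 1)

lemma br_unit (a : Fˣ) : br (a : F) = wmk (MonoidAlgebra.single a 1) := by
  simp [br]

/-- the Witt class of a list -/
noncomputable def cl (m : List Fˣ) : W F := (m.map fun a => br (a : F)).sum

@[simp] lemma cl_nil : cl ([] : List Fˣ) = 0 := rfl
@[simp] lemma cl_cons (a : Fˣ) (m : List Fˣ) : cl (a :: m) = br (a : F) + cl m := by simp [cl]
@[simp] lemma cl_append (l m : List Fˣ) : cl (l ++ m) = cl l + cl m := by simp [cl]

lemma cl_eq_mk (m : List Fˣ) : cl m = wmk (cl0 m) := by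
  induction m with
  | nil => simp [cl0]
  | cons a m ih => simp [ih, cl0, br_unit]

@[simp] lemma br_zero : br (0 : F) = 0 := by simp [br]

lemma br_mul (a b : F) : br (a * b) = br a * br b := by
  by_cases ha : a = 0
  · simp [ha]
  by_cases hb : b = 0
  · simp [hb]
  lift a to Fˣ using IsUnit.mk0 a ha
  lift b to Fˣ using IsUnit.mk0 b hb
  rw [← Units.val_mul, br_unit, br_unit, br_unit, ← map_mul, MonoidAlgebra.single_mul_single, mul_one]

@[simp] lemma br_one : br (1 : F) = 1 := by
  rw [← Units.val_one, br_unit]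
  exact map_one wmk

@[simp] lemma cl_map (a : Fˣ) (m : List Fˣ) : cl (m.map (a * ·)) = br (a : F) * cl m := by
  induction m with
  | nil => simp
  | cons b m ih => simp [ih, br_mul, mul_add]

variable [NeZero (2 : F)]

lemma cl_eq_zero {m : List Fˣ} : cl m = 0 ↔ Met m := by
  rw [cl_eq_mk, ← cl0_mem]
  exact Ideal.Quotient.eq_zero_iff_mem

lemma cl_of_eqv {l m : List Fˣ} (h : (dq l).Equiv (dq m)) : cl l = cl m := by
  have h1 := cl_eq_zero.2 (Met_graph h)
  have h2 := cl_eq_zero.2 (Met_graph (eqv_refl (dq m)))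
  rw [cl_append] at h1 h2
  linear_combination h1 - h2

@[simp] lemma br_neg_one : br (-1 : F) = -1 := by
  have h := cl_eq_zero.2 (Met_graph (eqv_refl (dq [(1 : Fˣ)])))
  simp at h
  linear_combination h

lemma br_neg (a : F) : br (-a) = - br a := by
  rw [← neg_one_mul, br_mul, br_neg_one, neg_one_mul]

lemma Ch.cl {l m : List Fˣ} (h : Ch l m) : cl l = WT.cl m := cl_of_eqv h.eqv

lemma br_sq {x : F} (hx : x ≠ 0) : br (x ^ 2) = 1 := by
  lift x to Fˣ using IsUnit.mk0 x hx
  have := (Ch.sq (1 : Fˣ) x []).cl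
  simp at this
  rw [pow_two]
  exact this.symm

lemma br_bin {a b c : F} (ha : a ≠ 0) (hb : b ≠ 0) (hc : c ≠ 0) (h : c = a + b) :
    br a + br b = br c + br a * br b * br c := by
  lift a to Fˣ using IsUnit.mk0 a ha
  lift b to Fˣ using IsUnit.mk0 b hb
  lift c to Fˣ using IsUnit.mk0 c hc
  have := (Ch.bin a b c [] h).cl
  simpa [br_mul] using this

lemma met_of_cl_eq {l m : List Fˣ} (h : cl l = cl m) : Met (l ++ m.map ((-1) * ·)) := by
  rw [← cl_eq_zero, cl_append, cl_map, h]
  simp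

lemma iso_of_cl {l m : List Fˣ} (h : cl l = cl m) (hlt : m.length < l.length) : Iso l :=
  (met_of_cl_eq h).iso_of_lt (by simpa using hlt)

lemma even_of_cl {l m : List Fˣ} (h : cl l = cl m) : Even (l.length + m.length) := by
  have := (met_of_cl_eq h).even
  simpa using this

end wittring
end WT

set_option linter.unusedSectionVars false
set_option linter.unusedVariables false
set_option linter.unusedSimpArgs false
namespace WT
open Module

section dlist
variable {F : Type} [Field F]

lemma D_zero (m : List Fˣ) : D m 0 := by
  induction m with
  | nil => rfl
  | cons a m ih => exact ⟨0, 0, ih, by simp⟩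

lemma D_cons_of {m : List Fˣ} {y : F} (a : Fˣ) (h : D m y) : D (a :: m) y := ⟨0, y, h, by simp⟩

lemma D_sq {m : List Fˣ} {y : F} (h : D m y) (t : F) : D m (t ^ 2 * y) := by
  induction m generalizing y with
  | nil => have : y = 0 := h; subst this; exact mul_zero _
  | cons a m ih =>
    obtain ⟨s, z, hz, rfl⟩ := h
    exact ⟨t * s, _, ih hz, by ring⟩

lemma D_append {l m : List Fˣ} {y : F} : D (l ++ m) y ↔ ∃ u v, D l u ∧ D m v ∧ y = u + v := by
  induction l generalizing y with
  | nil =>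
    constructor
    · intro h; exact ⟨0, y, rfl, h, by simp⟩
    · rintro ⟨u, v, hu, hv, rfl⟩
      have : u = 0 := hu
      subst this
      simpa using hv
  | cons a l ih =>
    constructor
    · rintro ⟨s, z, hz, rfl⟩
      obtain ⟨u, v, hu, hv, rfl⟩ := ih.1 hz
      exact ⟨_, v, ⟨s, u, hu, rfl⟩, hv, by ring⟩
    · rintro ⟨_, v, ⟨s, u, hu, rfl⟩, hv, rfl⟩
      exact ⟨s, u + v, ih.2 ⟨u, v, hu, hv, rfl⟩, by ring⟩

lemma D_map {a : Fˣ} {m : List Fˣ} {y : F} : D (m.map (a * ·)) y ↔ ∃ z, D m z ∧ y = a * z := by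
  induction m generalizing y with
  | nil =>
    constructor
    · intro h; exact ⟨0, rfl, by rw [mul_zero]; exact h⟩
    · rintro ⟨z, hz, rfl⟩
      have : z = 0 := hz
      subst this
      exact mul_zero _
  | cons b m ih =>
    constructor
    · rintro ⟨s, z, hz, rfl⟩
      obtain ⟨w, hw, rfl⟩ := ih.1 hz
      exact ⟨_, ⟨s, w, hw, rfl⟩, by push_cast; ring⟩
    · rintro ⟨_, ⟨s, w, hw, rfl⟩, rfl⟩
      exact ⟨s, a * w, ih.2 ⟨w, hw, rfl⟩, by push_cast; ring⟩

lemma D_mem {m : List Fˣ} {a : Fˣ} (h : a ∈ m) : D m (a : F) := by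
  induction m with
  | nil => simp at h
  | cons b m ih =>
    rcases List.mem_cons.1 h with rfl | h
    · exact ⟨1, 0, D_zero _, by simp⟩
    · exact D_cons_of _ (ih h)

lemma D_emb {L : Type} [Field L] (f : F →+* L) {m : List Fˣ} {y : F} (h : D m y) :
    D (m.map (Units.map (f : F →* L))) (f y) := by
  induction m generalizing y with
  | nil => have : y = 0 := h; subst this; exact map_zero f
  | cons a m ih =>
    obtain ⟨s, z, hz, rfl⟩ := h
    exact ⟨f s, f z, ih hz, by simp⟩

lemma Iso_append {l m : List Fˣ} (h : Iso (l ++ m)) :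
    Iso l ∨ Iso m ∨ ∃ y : F, y ≠ 0 ∧ D l y ∧ D m (-y) := by
  induction l with
  | nil => exact Or.inr (Or.inl h)
  | cons a l ih =>
    rcases h with h | ⟨s, hs, h⟩
    · rcases ih h with h | h | ⟨y, h0, h1, h2⟩
      · exact Or.inl (Or.inl h)
      · exact Or.inr (Or.inl h)
      · exact Or.inr (Or.inr ⟨y, h0, D_cons_of _ h1, h2⟩)
    · obtain ⟨u, v, hu, hv, e⟩ := D_append.1 h
      by_cases hv0 : v = 0
      · left; right
        refine ⟨s, hs, ?_⟩
        rw [e, hv0, add_zero]; exact hu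
      · right; right
        refine ⟨-v, neg_ne_zero.2 hv0, ⟨s, u, hu, ?_⟩, by rwa [neg_neg]⟩
        linear_combination e

lemma Iso_map {a : Fˣ} {m : List Fˣ} (h : Iso (m.map (a * ·))) : Iso m := by
  induction m with
  | nil => exact h
  | cons b m ih =>
    rcases h with h | ⟨s, hs, h⟩
    · exact Or.inl (ih h)
    · right
      obtain ⟨z, hz, e⟩ := D_map.1 h
      refine ⟨s, hs, ?_⟩
      have : -(b * s ^ 2 : F) = z := by
        have ha := a.ne_zero
        apply mul_left_cancel₀ ha
        rw [← e]; push_cast; ring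
      rwa [this]

lemma Ch_of_D {m : List Fˣ} {b : F} (h : D m b) (hb : b ≠ 0) :
    ∃ m', Ch m (Units.mk0 b hb :: m') := by
  induction m generalizing b with
  | nil => exact absurd h hb
  | cons a m ih =>
    obtain ⟨s, z, hz, e⟩ := h
    by_cases hz0 : z = 0
    · have hs : s ≠ 0 := by
        rintro rfl
        apply hb; simp [e, hz0]
      refine ⟨m, ?_⟩
      have : Units.mk0 b hb = a * (Units.mk0 s hs * Units.mk0 s hs) := by
        ext; simp [e, hz0, pow_two]
      rw [this]
      exact Ch.sq _ _ _
    · obtain ⟨m', hm'⟩ := ih hz hz0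
      by_cases hs : s = 0
      · refine ⟨a :: m', ?_⟩
        have : Units.mk0 b hb = Units.mk0 z hz0 := by ext; simp [e, hs]
        rw [this]
        exact (hm'.cons a).trans (Ch.swap _ _ _)
      · refine ⟨_ :: m', (Ch.sq a (Units.mk0 s hs) m).trans ((hm'.cons _).trans
          (Ch.bin _ _ _ _ ?_))⟩
        simp [e, pow_two]

lemma Ch_of_Iso {m : List Fˣ} (h : Iso m) : ∃ c m', Ch m (c :: -c :: m') := by
  induction m with
  | nil => exact absurd h id
  | cons a m ih =>
    rcases h with h | ⟨s, hs, h⟩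
    · obtain ⟨c, m', hc⟩ := ih h
      exact ⟨c, a :: m', (hc.cons a).trans ((Ch.swap _ _ _).trans ((Ch.swap _ _ _).cons _))⟩
    · have hb : -((a : F) * s ^ 2) ≠ 0 := by simp [hs]
      obtain ⟨m', hm⟩ := Ch_of_D h hb
      refine ⟨a * (Units.mk0 s hs * Units.mk0 s hs), m', (hm.cons a).trans ?_⟩
      have : Units.mk0 _ hb = - (a * (Units.mk0 s hs * Units.mk0 s hs)) := by
        ext; simp [pow_two]
      rw [this]
      exact Ch.sq _ _ _

variable [NeZero (2 : F)]

lemma D_of_Iso {m : List Fˣ} (h : Iso m) (y : F) : D m y := by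
  have key : ∀ (a : Fˣ) (s u : F), s ≠ 0 → ∃ t k : F, u = a * t ^ 2 + k ^ 2 * (-(a * s ^ 2)) := by
    intro a s u hs
    have h2 : (2 : F) ≠ 0 := two_ne_zero
    have ha := a.ne_zero
    refine ⟨(u / a + 1) / 2, (u / a - 1) / (2 * s), ?_⟩
    field_simp
    ring
  induction m generalizing y with
  | nil => exact absurd h id
  | cons a m ih =>
    rcases h with h | ⟨s, hs, h⟩
    · exact D_cons_of _ (ih h y)
    · obtain ⟨t, k, e⟩ := key a s y hs
      exact ⟨t, _, D_sq h k, e⟩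

lemma cl_of_D {m : List Fˣ} {b : F} (h : D m b) (hb : b ≠ 0) :
    ∃ m', cl m = br b + cl m' ∧ m'.length + 1 = m.length := by
  obtain ⟨m', h⟩ := Ch_of_D h hb
  exact ⟨m', by simpa using h.cl, by simpa using h.length.symm⟩

lemma cl_of_Iso {m : List Fˣ} (h : Iso m) :
    ∃ m', cl m = cl m' ∧ m'.length + 2 = m.length := by
  obtain ⟨c, m', h⟩ := Ch_of_Iso h
  refine ⟨m', ?_, by simpa using h.length.symm⟩
  rw [h.cl]
  simp [br_neg]

/-- cl (m ++ [-b]) shorter implies b ∈ D m -/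
lemma D_of_cl {m m' : List Fˣ} {b : F} (hb : b ≠ 0) (h : cl m = br b + cl m')
    (hlen : m'.length < m.length + 1) : D m b := by
  have : Iso (m ++ [- Units.mk0 b hb]) := by
    refine iso_of_cl (m := m') ?_ (by simpa using hlen)
    simp [h, br_neg]
  rcases Iso_append this with h | h | ⟨y, h0, h1, s, z, hz, e⟩
  · exact D_of_Iso h b
  · rcases h with h | ⟨s, hs, h⟩
    · exact absurd h id
    · have : -(((- Units.mk0 b hb : Fˣ) : F) * s ^ 2) = 0 := h
      simp [hb, hs] at this
  · have hz : z = 0 := hz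
    subst hz
    simp at e
    have hs : s ≠ 0 := by
      rintro rfl; simp [h0] at e
    have : b = (s⁻¹) ^ 2 * y := by rw [e]; field_simp
    rw [this]
    exact D_sq h1 _

/-- induction for metabolic lists -/
lemma met_induction {P : List Fˣ → Prop} (h0 : P []) (h1 : ∀ m c m', Ch m (c :: -c :: m') → P m' → P m)
    (m : List Fˣ) (h : cl m = 0) : P m := by
  induction hn : m.length using Nat.strong_induction_on generalizing m with
  | _ n ih =>
    subst hn
    cases m with
    | nil => exact h0
    | cons a m =>
      have : Iso (a :: m) := iso_of_cl (m := []) (by simpa using h) (by simp)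
      obtain ⟨c, m', hc⟩ := Ch_of_Iso this
      refine h1 _ c m' hc (ih m'.length ?_ m' ?_ rfl)
      · rw [hc.length]; simp
      · have := hc.cl
        rw [h] at this
        simpa [br_neg] using this.symm

lemma cl_map_eq_zero {L : Type} [Field L] [NeZero (2 : L)] (f : F →+* L) (m : List Fˣ) (h : cl m = 0) :
    cl (m.map (Units.map (f : F →* L))) = 0 := by
  refine met_induction (P := fun m => cl (m.map (Units.map (f : F →* L))) = 0) (by simp) ?_ m h
  intro m c m' hc h
  have e := (hc.map f).cl
  simp [h, br_neg] at e
  exact e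

/-- functoriality of the Witt ring -/
noncomputable def wmap {L : Type} [Field L] [NeZero (2 : L)] (f : F →+* L) : W F →+* W L :=
  Ideal.Quotient.lift (WI F) (wmk.comp (MonoidAlgebra.mapDomainRingHom ℤ (Units.map (f : F →* L)))) (by
    intro a ha
    have key : ∀ m : List Fˣ, wmk (MonoidAlgebra.mapDomainRingHom ℤ (Units.map (f : F →* L)) (cl0 m)) =
        cl (m.map (Units.map (f : F →* L))) := by
      intro m
      rw [cl_eq_mk]
      congr 1
      simp only [cl0, map_list_sum, List.map_map]
      congr 1
      apply List.map_congr_left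
      intro a _
      simp
    obtain ⟨l, m, hl, hm, rfl⟩ := mem_WI ha
    rw [map_sub, RingHom.comp_apply, RingHom.comp_apply, key, key,
      cl_map_eq_zero f l (cl_eq_zero.2 hl), cl_map_eq_zero f m (cl_eq_zero.2 hm), sub_zero])

lemma wmap_br {L : Type} [Field L] [NeZero (2 : L)] (f : F →+* L) (a : F) : wmap f (br a) = br (f a) := by
  by_cases ha : a = 0
  · simp [ha]
  lift a to Fˣ using IsUnit.mk0 a ha
  have : f (a : F) = (Units.map (f : F →* L) a : Lˣ) := rfl
  rw [this, br_unit, br_unit]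
  have h : wmap f (wmk (MonoidAlgebra.single a 1)) = wmk (MonoidAlgebra.mapDomainRingHom ℤ (Units.map (f : F →* L)) (MonoidAlgebra.single a 1)) := rfl
  rw [h]
  simp

lemma wmap_cl {L : Type} [Field L] [NeZero (2 : L)] (f : F →+* L) (m : List Fˣ) :
    wmap f (cl m) = cl (m.map (Units.map (f : F →* L))) := by
  induction m with
  | nil => simp
  | cons a m ih => simp [ih, wmap_br]

end dlist
end WT

set_option linter.unusedSectionVars false
set_option linter.unusedVariables false
set_option linter.unusedSimpArgs false
namespace WT
open Module
open scoped TensorProduct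

section bridge
variable {F : Type} [Field F]

lemma wss2_apply (w : Fin 2 → F) (x : Fin 2 → F) :
    QuadraticMap.weightedSumSquares F w x = w 0 * (x 0 * x 0) + w 1 * (x 1 * x 1) := by
  simp [QuadraticMap.weightedSumSquares_apply, Fin.sum_univ_two]

lemma wss1_apply (w : Fin 1 → F) (x : Fin 1 → F) :
    QuadraticMap.weightedSumSquares F w x = w 0 * (x 0 * x 0) := by
  simp [QuadraticMap.weightedSumSquares_apply]

lemma bin_eqv (a : F) : (QF.bin a).Equiv ((un 1).add (un (-a))) := by
  refine ⟨⟨LinearEquiv.finTwoArrow F F, fun (x : Fin 2 → F) => ?_⟩⟩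
  have := wss2_apply ![1, -a] x
  exact this.symm

lemma one_eqv : (QF.one : QF F).Equiv (un 1) := by
  refine ⟨⟨LinearEquiv.funUnique (Fin 1) F F, fun (x : Fin 1 → F) => ?_⟩⟩
  exact (wss1_apply (fun _ => 1) x).symm

lemma hyp_plane [NeZero (2 : F)] {c : F} (hc : c ≠ 0) : ((un c).add (un (-c))).Equiv (QF.bin 1) := by
  have h2 : (2 : F) ≠ 0 := two_ne_zero
  refine eqv_trans ?_ (eqv_symm (bin_eqv 1))
  let f : F × F →ₗ[F] F × F := 
    { toFun := fun x => (((c + 1) * x.1 + (c - 1) * x.2) / 2, ((c - 1) * x.1 + (c + 1) * x.2) / 2)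
      map_add' := fun x y => by ext <;> simp <;> ring
      map_smul' := fun r x => by ext <;> simp <;> ring }
  let g : F × F →ₗ[F] F × F := 
    { toFun := fun x => (((c + 1) * x.1 - (c - 1) * x.2) / (2 * c), (-(c - 1) * x.1 + (c + 1) * x.2) / (2 * c))
      map_add' := fun x y => by ext <;> simp <;> ring
      map_smul' := fun r x => by ext <;> simp <;> ring }
  have hgf : ∀ x, g (f x) = x := by
    rintro ⟨x, y⟩
    apply Prod.ext
    · show ((c + 1) * (((c + 1) * x + (c - 1) * y) / 2) - (c - 1) * (((c - 1) * x + (c + 1) * y) / 2)) / (2 * c) = x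
      field_simp; ring
    · show (-(c - 1) * (((c + 1) * x + (c - 1) * y) / 2) + (c + 1) * (((c - 1) * x + (c + 1) * y) / 2)) / (2 * c) = y
      field_simp; ring
  have hfg : ∀ x, f (g x) = x := by
    rintro ⟨x, y⟩
    apply Prod.ext
    · show ((c + 1) * (((c + 1) * x - (c - 1) * y) / (2 * c)) + (c - 1) * ((-(c - 1) * x + (c + 1) * y) / (2 * c))) / 2 = x
      field_simp; ring
    · show ((c - 1) * (((c + 1) * x - (c - 1) * y) / (2 * c)) + (c + 1) * ((-(c - 1) * x + (c + 1) * y) / (2 * c))) / 2 = y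
      field_simp; ring
  let e : (F × F) ≃ₗ[F] (F × F) := LinearEquiv.ofLinearMap f g (LinearMap.ext hfg) (LinearMap.ext hgf)
  refine ⟨⟨e, ?_⟩⟩
  rintro ⟨(x : F), (y : F)⟩
  show (1 : F) * ((((c + 1) * x + (c - 1) * y) / 2) * (((c + 1) * x + (c - 1) * y) / 2)) +
    (-1) * ((((c - 1) * x + (c + 1) * y) / 2) * (((c - 1) * x + (c + 1) * y) / 2)) =
    c * (x * x) + (-c) * (y * y)
  field_simp
  ring

lemma tmul_bin [Invertible (2 : F)] (a : F) (ψ : QF F) :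
    ((QF.bin a).tmul ψ).Equiv (ψ.add (ψ.smul (-a))) := by
  refine eqv_symm ?_
  let e : (Fin 2 → F) ⊗[F] ψ.V ≃ₗ[F] ψ.V × ψ.V :=
    (TensorProduct.comm F (Fin 2 → F) ψ.V).trans
      ((TensorProduct.piScalarRight F F ψ.V (Fin 2)).trans (LinearEquiv.finTwoArrow F ψ.V))
  have he : ∀ (x : ψ.V × ψ.V), e.symm x = (![1, 0] : Fin 2 → F) ⊗ₜ x.1 + (![0, 1] : Fin 2 → F) ⊗ₜ x.2 := by
    intro x
    rw [LinearEquiv.symm_apply_eq]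
    ext <;> simp [e]
  refine ⟨⟨e.symm, fun x => ?_⟩⟩
  have key : ∀ v w : ψ.V, (QuadraticForm.tmul (QuadraticMap.weightedSumSquares F ![(1 : F), -a]) ψ.q)
      ((![1, 0] : Fin 2 → F) ⊗ₜ v + (![0, 1] : Fin 2 → F) ⊗ₜ w) = ψ.q v + (-a) * ψ.q w := by
    intro v w
    have h1 := congrArg (fun B => B ((![1, 0] : Fin 2 → F) ⊗ₜ v) ((![0, 1] : Fin 2 → F) ⊗ₜ w))
      (QuadraticForm.polarBilin_tmul (A := F) (QuadraticMap.weightedSumSquares F ![(1 : F), -a]) ψ.q)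
    have h2 : QuadraticMap.polar (QuadraticMap.weightedSumSquares F ![(1 : F), -a]) ![1, 0] ![0, 1] = 0 := by
      simp [QuadraticMap.polar, wss2_apply]
    simp [h2] at h1
    rw [QuadraticMap.polar] at h1
    rw [sub_sub, sub_eq_zero] at h1
    rw [h1]
    rw [QuadraticForm.tensorDistrib_tmul, QuadraticForm.tensorDistrib_tmul]
    simp [wss2_apply, mul_comm]
  refine (congrArg _ (he x)).trans ?_
  exact key x.1 x.2

lemma baseChange_eqv [Invertible (2 : F)] {L : Type} [Field L] [Algebra F L] {φ ψ : QF F} (h : φ.Equiv ψ) :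
    (φ.baseChange L).Equiv (ψ.baseChange L) := by
  obtain ⟨e⟩ := h
  let g : L ⊗[F] φ.V ≃ₗ[L] L ⊗[F] ψ.V := e.toLinearEquiv.baseChange F L φ.V ψ.V
  have : (QuadraticForm.baseChange L ψ.q).comp g.toLinearMap = QuadraticForm.baseChange L φ.q := by
    apply baseChange_ext
    intro m
    simp [g]
  exact ⟨⟨g, fun x => congrArg (fun q => q x) this⟩⟩

lemma baseChange_add [Invertible (2 : F)] {L : Type} [Field L] [Algebra F L] (φ ψ : QF F) :
    ((φ.add ψ).baseChange L).Equiv ((φ.baseChange L).add (ψ.baseChange L)) := by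
  let g : L ⊗[F] (φ.V × ψ.V) ≃ₗ[L] (L ⊗[F] φ.V) × (L ⊗[F] ψ.V) := TensorProduct.prodRight F L L φ.V ψ.V
  have : ((QuadraticForm.baseChange L φ.q).prod (QuadraticForm.baseChange L ψ.q)).comp g.toLinearMap
      = QuadraticForm.baseChange L (φ.q.prod ψ.q) := by
    apply baseChange_ext
    intro m
    simp [g, add_smul]
  exact ⟨⟨g, fun x => congrArg (fun q => q x) this⟩⟩

lemma baseChange_un [Invertible (2 : F)] {L : Type} [Field L] [Algebra F L] (a : F) :
    ((un a).baseChange L).Equiv (un (algebraMap F L a)) := by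
  let g : L ⊗[F] F ≃ₗ[L] L := TensorProduct.AlgebraTensorModule.rid F L L
  have : (algebraMap F L a • QuadraticMap.sq (R := L)).comp g.toLinearMap
      = QuadraticForm.baseChange L (a • QuadraticMap.sq (R := F)) := by
    apply baseChange_ext
    intro m
    simp [g, Algebra.smul_def]
  exact ⟨⟨g, fun x => congrArg (fun q => q x) this⟩⟩

lemma baseChange_zero [Invertible (2 : F)] {L : Type} [Field L] [Algebra F L] :
    ((QF.zero : QF F).baseChange L).Equiv QF.zero := by
  let g : L ⊗[F] (Fin 0 → F) ≃ₗ[L] (Fin 0 → L) := TensorProduct.piScalarRight F L L (Fin 0)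
  have : (QuadraticMap.weightedSumSquares L (fun i : Fin 0 => (1 : L))).comp g.toLinearMap
      = QuadraticForm.baseChange L (QuadraticMap.weightedSumSquares F (fun i : Fin 0 => (1 : F))) := by
    apply baseChange_ext
    intro m
    simp [zero_q]
  exact ⟨⟨g, fun x => congrArg (fun q => q x) this⟩⟩

lemma baseChange_dq [Invertible (2 : F)] {L : Type} [Field L] [Algebra F L] (m : List Fˣ) :
    ((dq m).baseChange L).Equiv (dq (m.map (Units.map (algebraMap F L : F →* L)))) := by
  induction m with
  | nil => exact baseChange_zero
  | cons a m ih => exact eqv_trans (baseChange_add _ _) (eqv_add (baseChange_un _) ih)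

lemma eqv_wss {r : ℕ} (w : Fin r → Fˣ) : ∃ m : List Fˣ,
    QuadraticMap.Equivalent (QuadraticMap.weightedSumSquares F w) (dq m).q := by
  induction r with
  | zero =>
    refine ⟨[], ⟨⟨LinearEquiv.refl F (Fin 0 → F), fun (x : Fin 0 → F) => ?_⟩⟩⟩
    refine (zero_q x).trans ?_
    simp [QuadraticMap.weightedSumSquares_apply]
  | succ r ih =>
    obtain ⟨m, ⟨e⟩⟩ := ih (fun i => w i.succ)
    let g : (Fin (r + 1) → F) ≃ₗ[F] F × (Fin r → F) := (Fin.consLinearEquiv F (fun _ => F)).symm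
    have : QuadraticMap.Equivalent (QuadraticMap.weightedSumSquares F w)
      (((un (w 0 : F)).q).prod (QuadraticMap.weightedSumSquares F (fun i : Fin r => w i.succ))) := by
      refine ⟨⟨g, fun x => ?_⟩⟩
      show ((w 0 : F)) * (x 0 * x 0) + (QuadraticMap.weightedSumSquares F (fun i : Fin r => w i.succ)) (fun i => x i.succ) = _
      simp [QuadraticMap.weightedSumSquares_apply, Fin.sum_univ_succ, Units.smul_def]
    exact ⟨w 0 :: m, this.trans (QuadraticMap.Equivalent.prod (QuadraticMap.Equivalent.refl _) ⟨e⟩)⟩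

lemma exists_dq [Invertible (2 : F)] (φ : QF F) (h : ND φ.q) : ∃ m, φ.Equiv (dq m) := by
  have h' : (QuadraticMap.associated (R := F) φ.q).SeparatingLeft := by
    intro x hx
    refine h x fun y => ?_
    have := hx y
    have h2 := QuadraticMap.two_nsmul_associated F φ.q
    have h3 := congrArg (fun B => B x y) h2
    have h4 : (2 : ℕ) • (QuadraticMap.associated (R := F) φ.q x y) = QuadraticMap.polar φ.q x y := h3
    rw [← h4, this]; simp
  obtain ⟨w, hw⟩ := φ.q.equivalent_weightedSumSquares_units_of_nondegenerate' h'
  obtain ⟨m, hm⟩ := eqv_wss w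
  exact ⟨m, hw.trans hm⟩

variable [NeZero (2 : F)]

/-- φ has Witt class x -/
def HasCls (φ : QF F) (x : W F) : Prop := ∃ m, φ.Equiv (dq m) ∧ cl m = x

lemma HasCls.uniq {φ : QF F} {x y : W F} (h : HasCls φ x) (h' : HasCls φ y) : x = y := by
  obtain ⟨m, e, rfl⟩ := h
  obtain ⟨m', e', rfl⟩ := h'
  exact cl_of_eqv (eqv_trans (eqv_symm e) e')

lemma HasCls.congr {φ ψ : QF F} {x : W F} (e : ψ.Equiv φ) (h : HasCls φ x) : HasCls ψ x := by
  obtain ⟨m, e', rfl⟩ := h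
  exact ⟨m, eqv_trans e e', rfl⟩

lemma HasCls.add {φ ψ : QF F} {x y : W F} (h : HasCls φ x) (h' : HasCls ψ y) :
    HasCls (φ.add ψ) (x + y) := by
  obtain ⟨m, e, rfl⟩ := h
  obtain ⟨m', e', rfl⟩ := h'
  exact ⟨m ++ m', eqv_trans (eqv_add e e') (eqv_symm (dq_append _ _)), cl_append _ _⟩

lemma HasCls.smul {φ : QF F} {x : W F} (h : HasCls φ x) {a : F} (ha : a ≠ 0) :
    HasCls (φ.smul a) (br a * x) := by
  obtain ⟨m, e, rfl⟩ := h
  exact ⟨m.map (Units.mk0 a ha * ·), eqv_trans (eqv_smul a e) (eqv_symm (dq_map _ _)), cl_map _ _⟩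

lemma HasCls.zero : HasCls (QF.zero : QF F) 0 := ⟨[], eqv_refl _, rfl⟩

lemma HasCls.un {a : F} (ha : a ≠ 0) : HasCls (un a) (br a) :=
  ⟨[Units.mk0 a ha], eqv_symm (eqv_add_zero _), by simp⟩

lemma HasCls.one : HasCls (QF.one : QF F) 1 := by
  have := (HasCls.un (F := F) one_ne_zero).congr one_eqv
  simpa using this

lemma HasCls.bin {a : F} (ha : a ≠ 0) : HasCls (QF.bin a) (1 - br a) := by
  have := ((HasCls.un (F := F) one_ne_zero).add (HasCls.un (neg_ne_zero.2 ha))).congr (bin_eqv a)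
  simpa [br_neg, sub_eq_add_neg] using this

lemma HasCls.tmul_bin [Invertible (2 : F)] {ψ : QF F} {x : W F} (h : HasCls ψ x) {a : F} (ha : a ≠ 0) :
    HasCls ((QF.bin a).tmul ψ) ((1 - br a) * x) := by
  have := (h.add (h.smul (neg_ne_zero.2 ha))).congr (WT.tmul_bin a ψ)
  convert this using 1
  rw [br_neg]; ring

lemma HasCls.hyperbolics (m : ℕ) : HasCls (QF.hyperbolics m : QF F) 0 := by
  induction m with
  | zero => exact HasCls.zero
  | succ m ih =>
    have := (HasCls.bin (F := F) one_ne_zero).add ih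
    show HasCls ((QF.bin 1).add (QF.hyperbolics m)) 0
    simpa using this

lemma HasCls.of_hyp {φ : QF F} (h : φ.IsHyperbolic) : HasCls φ 0 := by
  obtain ⟨m, e⟩ := h
  exact (HasCls.hyperbolics m).congr e

lemma HasCls.isHyp {φ : QF F} (h : HasCls φ 0) : φ.IsHyperbolic := by
  obtain ⟨m, e, h⟩ := h
  have : (dq m).IsHyperbolic := by
    refine met_induction (P := fun m => (dq m).IsHyperbolic) ⟨0, eqv_refl _⟩ ?_ m h
    rintro m c m' hc ⟨k, hk⟩
    refine ⟨k + 1, eqv_trans hc.eqv (eqv_trans (eqv_symm (eqv_add_assoc _ _ _)) (eqv_add ?_ hk))⟩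
    have := hyp_plane (F := F) c.ne_zero
    simpa using this
  obtain ⟨k, hk⟩ := this
  exact ⟨k, eqv_trans e hk⟩

lemma HasCls.nd {φ : QF F} {x : W F} (h : HasCls φ x) : ND φ.q := by
  obtain ⟨m, e, -⟩ := h
  exact ND.congr (eqv_symm e) (ND_dq m)

lemma HasCls.nsmul {φ : QF F} {x : W F} (h : HasCls φ x) (n : ℕ) : HasCls (QF.nsmul n φ) (n * x) := by
  induction n with
  | zero =>
    show HasCls QF.zero _
    simpa using HasCls.zero
  | succ n ih =>
    have := h.add ih
    show HasCls (φ.add (QF.nsmul n φ)) _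
    have h2 : ((n + 1 : ℕ) : W F) * x = x + n * x := by push_cast; ring
    rw [h2]; exact this

lemma HasCls.baseChange [Invertible (2 : F)] {L : Type} [Field L] [Algebra F L] [NeZero (2 : L)]
    {φ : QF F} {x : W F} (h : HasCls φ x) : HasCls (φ.baseChange L) (wmap (algebraMap F L) x) := by
  obtain ⟨m, e, rfl⟩ := h
  exact ⟨_, eqv_trans (baseChange_eqv e) (baseChange_dq m), (wmap_cl _ _).symm⟩

/-- Pfister class -/
noncomputable def pf (l : List Fˣ) : W F := (l.map fun a => 1 - br (a : F)).prod

@[simp] lemma pf_nil : pf ([] : List Fˣ) = 1 := rfl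
@[simp] lemma pf_cons (a : Fˣ) (l : List Fˣ) : pf (a :: l) = (1 - br (a : F)) * pf l := by simp [pf]
@[simp] lemma pf_append (l m : List Fˣ) : pf (l ++ m) = pf l * pf m := by simp [pf]

lemma HasCls.pfister [Invertible (2 : F)] (l : List Fˣ) :
    HasCls (QF.pfister (l.map fun a => (a : F))) (pf l) := by
  induction l with
  | nil => exact HasCls.one
  | cons a l ih =>
    show HasCls ((QF.bin (a : F)).tmul (QF.pfister (l.map fun a => (a : F)))) _
    rw [pf_cons]; exact ih.tmul_bin a.ne_zero

lemma pfister_nontrivial [Invertible (2 : F)] (l : List F) : Nontrivial (QF.pfister l).V := by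
  induction l with
  | nil => exact inferInstanceAs (Nontrivial (Fin 1 → F))
  | cons a l ih =>
    have h : finrank F ((Fin 2 → F) ⊗[F] (QF.pfister l).V) ≠ 0 := by
      rw [Module.finrank_tensorProduct]
      have := (Module.finrank_pos_iff (R := F) (M := (QF.pfister l).V)).2 ih
      simp
      omega
    have : Nontrivial ((Fin 2 → F) ⊗[F] (QF.pfister l).V) :=
      Module.nontrivial_of_finrank_pos (R := F) (Nat.pos_of_ne_zero h)
    exact this

lemma ND_smul_zero {φ : QF F} (h : ND (φ.smul 0).q) : Subsingleton φ.V := by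
  refine ⟨fun x y => ?_⟩
  have : ∀ x : φ.V, x = 0 := fun x => h x fun y => by
    show QuadraticMap.polar (fun x => (0 : F) * φ.q x) x y = 0
    simp [QuadraticMap.polar]
  rw [this x, this y]

lemma pfister_ne_zero [Invertible (2 : F)] (l : List F) (h : ND (QF.pfister l).q) : ∀ a ∈ l, a ≠ 0 := by
  induction l with
  | nil => simp
  | cons a l ih =>
    have := ND.of_prod (ND.congr (WT.tmul_bin a (QF.pfister l)) h)
    intro b hb
    rcases List.mem_cons.1 hb with rfl | hb
    · rintro rfl
      have h2 := this.2
      have h3 : ND ((QF.pfister l).smul (-0)).q := h2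
      rw [neg_zero] at h3
      have hs := ND_smul_zero h3
      have := pfister_nontrivial l
      exact not_subsingleton _ hs
    · exact ih this.1 b hb

end bridge
end WT

set_option linter.unusedSectionVars false
set_option linter.unusedVariables false
set_option linter.unusedSimpArgs false
namespace WT
open Module

section pfister
variable {F : Type} [Field F]

/-- diagonalization of a Pfister form -/
def ent : List Fˣ → List Fˣ
  | [] => [1]
  | a :: l => ent l ++ (ent l).map ((-a) * ·)

/-- relative pure part -/
def pe (γ : List Fˣ) : List Fˣ → List Fˣ
  | [] => []
  | a :: l => pe γ l ++ (ent (γ ++ l)).map (a * ·)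

lemma length_ent (l : List Fˣ) : (ent l).length = 2 ^ l.length := by
  induction l with
  | nil => rfl
  | cons a l ih => simp [ent, ih, pow_succ]; ring

lemma length_pe (γ l l' : List Fˣ) (h : l.length = l'.length) : (pe γ l).length = (pe γ l').length := by
  induction l generalizing l' with
  | nil =>
    cases l' with
    | nil => rfl
    | cons => simp at h
  | cons a l ih =>
    cases l' with
    | nil => simp at h
    | cons a' l' =>
      have h' : l.length = l'.length := by simpa using h
      simp [pe, length_ent, ih l' h', h']

lemma length_pe' (l : List Fˣ) : (pe [] l).length + 1 = 2 ^ l.length := by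
  induction l with
  | nil => rfl
  | cons a l ih => simp [pe, length_ent, pow_succ]; omega

lemma D_ent_one (l : List Fˣ) : D (ent l) (1 : F) := by
  induction l with
  | nil => exact ⟨1, 0, rfl, by simp⟩
  | cons a l ih => exact D_append.2 ⟨1, 0, ih, D_zero _, by simp⟩

variable [NeZero (2 : F)]

lemma cl_ent (l : List Fˣ) : cl (ent l) = pf l := by
  induction l with
  | nil => simp [ent]
  | cons a l ih => rw [ent, cl_append, cl_map, ih, pf_cons]; push_cast; rw [br_neg]; ring

lemma cl_pe (γ l : List Fˣ) : cl (pe γ l) = pf γ * (1 - pf l) := by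
  induction l with
  | nil => simp [pe]
  | cons a l ih => rw [pe, cl_append, cl_map, cl_ent, ih, pf_cons, pf_append]; ring

lemma D_transfer {m m' : List Fˣ} (h : cl m = cl m') (hl : m'.length ≤ m.length) {b : F} (hb : b ≠ 0)
    (hD : D m' b) : D m b := by
  obtain ⟨m2, h2, h3⟩ := cl_of_D hD hb
  exact D_of_cl hb (h.trans h2) (by omega)

/-- roundness -/
lemma round {l : List Fˣ} {y : F} (h : D (ent l) y) (hy : y ≠ 0) : br y * pf l = pf l := by
  induction l generalizing y with
  | nil =>
    obtain ⟨s, z, hz, rfl⟩ := h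
    have : z = 0 := hz
    subst this
    have hs : s ≠ 0 := by rintro rfl; simp at hy
    simp [br_sq hs]
  | cons a l ih =>
    obtain ⟨u, w, hu, hw, rfl⟩ := D_append.1 h
    obtain ⟨v, hv, rfl⟩ := D_map.1 hw
    rw [pf_cons]
    by_cases hu0 : u = 0
    · have hv0 : v ≠ 0 := by rintro rfl; simp [hu0] at hy
      have h1 := ih hv hv0
      have ha := br_sq a.ne_zero
      rw [pow_two, br_mul] at ha
      subst hu0
      push_cast
      rw [zero_add, br_mul, br_neg]
      linear_combination (-br (a : F) * (1 - br (a : F))) * h1 + (pf l) * ha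
    by_cases hv0 : v = 0
    · have h1 := ih hu hu0
      subst hv0
      rw [mul_zero, add_zero]
      linear_combination (1 - br (a : F)) * h1
    have h1 := ih hu hu0
    have h2 := ih hv hv0
    have hb := br_bin hu0 (mul_ne_zero (neg_ne_zero.2 a.ne_zero) hv0) (by simpa using hy) rfl
    push_cast
    rw [br_mul, br_neg] at hb
    generalize br (u + -(a : F) * v) = Y at *
    linear_combination -pf l * hb + (1 + Y * br (a : F) * br v) * h1 + (- br (a : F) + Y * br (a : F)) * h2

lemma pf_of_Iso {l : List Fˣ} (h : Iso (ent l)) : pf l = 0 := by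
  induction l with
  | nil =>
    rcases h with h | ⟨s, hs, h⟩
    · exact absurd h id
    · have : -((1 : Fˣ) * s ^ 2 : F) = 0 := h
      simp at this; exact absurd this hs
  | cons a l ih =>
    rw [pf_cons]
    rcases Iso_append h with h | h | ⟨y, hy, h1, h2⟩
    · rw [ih h, mul_zero]
    · rw [ih (Iso_map h), mul_zero]
    · obtain ⟨z, hz, e⟩ := D_map.1 h2
      have e' : y = a * z := by push_cast at e; linear_combination -e
      have hz0 : z ≠ 0 := by rintro rfl; simp [e'] at hy
      have r1 := round h1 hy
      have r2 := round hz hz0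
      rw [e', br_mul] at r1
      linear_combination br (a : F) * r2 - r1

lemma Iso_of_pf {l : List Fˣ} (h : pf l = 0) : Iso (ent l) :=
  iso_of_cl (m := []) (by rw [cl_ent, h]; rfl) (by rw [length_ent]; exact Nat.two_pow_pos _)

/-- a list of smaller length representing pf -/
lemma pf_of_short {l m : List Fˣ} (h : pf l = cl m) (hl : m.length < 2 ^ l.length) : pf l = 0 :=
  pf_of_Iso (iso_of_cl (m := m) (by rw [cl_ent, h]) (by rwa [length_ent]))

def Pure (J : Ideal (W F)) (γ : List Fˣ) : List Fˣ → F → Prop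
  | [], x => x = 0
  | a :: l, z => ∃ x y, Pure J γ l x ∧ (y = 0 ∨ (1 - br y) * (pf γ * pf l) ∈ J) ∧ z = x + a * y

lemma Pure.mono {J : Ideal (W F)} {γ l : List Fˣ} {z : F} (c : Fˣ) (h : Pure J γ l z) :
    Pure J (c :: γ) l z := by
  induction l generalizing z with
  | nil => exact h
  | cons a l ih =>
    obtain ⟨x, y, hx, hy, rfl⟩ := h
    refine ⟨x, y, ih hx, hy.imp_right fun hy => ?_, rfl⟩
    have := J.mul_mem_left (1 - br (c : F)) hy
    convert this using 1
    rw [pf_cons]; ring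

lemma bin2 {u v : F} (hu : u ≠ 0) (hv : v ≠ 0) (h : u + v ≠ 0) :
    (1 - br u) * (1 - br v) = (1 - br (u + v)) * (1 - br (-(u * v))) := by
  have h1 := br_bin hu hv h rfl
  rw [br_neg, br_mul]
  linear_combination -h1

lemma pureSub {J : Ideal (W F)} {N : ℕ} (hJ : ∀ l : List Fˣ, l.length = N → pf l ∈ J → pf l = 0)
    {γ l : List Fˣ} (hl : γ.length + l.length = N) {b : F} (hb : b ≠ 0) (h : Pure J γ l b) :
    ∃ l2 : List Fˣ, l2.length + 1 = l.length ∧ pf γ * pf l = pf γ * ((1 - br b) * pf l2) := by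
  induction l generalizing γ b with
  | nil => exact absurd h hb
  | cons a l ih =>
    obtain ⟨x, y, hx, hy, rfl⟩ := h
    by_cases hy0 : y = 0
    · subst hy0
      simp only [mul_zero, add_zero] at hb ⊢
      obtain ⟨l2, h1, h2⟩ := ih (γ := a :: γ) (by simpa [add_assoc, add_comm 1] using hl) hb (hx.mono a)
      refine ⟨a :: l2, by simpa using h1, ?_⟩
      rw [pf_cons] at h2 ⊢
      rw [pf_cons]
      linear_combination h2
    have hyv : (1 - br y) * (pf γ * pf l) = 0 := by
      have h1 := hy.resolve_left hy0
      have := hJ (Units.mk0 y hy0 :: γ ++ l) (by simp at hl ⊢; omega) (by simpa [mul_assoc] using h1)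
      simpa [mul_assoc] using this
    by_cases hx0 : x = 0
    · subst hx0
      refine ⟨l, by simp, ?_⟩
      rw [pf_cons, zero_add, br_mul]
      linear_combination -br (a : F) * hyv
    have hay : (a : F) * y ≠ 0 := mul_ne_zero a.ne_zero hy0
    obtain ⟨l2, h1, h2⟩ := ih (γ := Units.mk0 _ hay :: γ) (by simp at hl ⊢; omega) hx0 (hx.mono _)
    have hc : -(x * (a * y)) ≠ 0 := neg_ne_zero.2 (mul_ne_zero hx0 hay)
    refine ⟨Units.mk0 _ hc :: l2, by simpa using h1, ?_⟩
    have h3 := bin2 hx0 hay hb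
    rw [pf_cons, Units.val_mk0] at h2
    rw [pf_cons, pf_cons, Units.val_mk0]
    rw [br_mul (a : F) y] at h2 h3
    linear_combination -br (a : F) * hyv + h2 + pf γ * pf l2 * h3

lemma Pure_of_D {J : Ideal (W F)} {γ δ : List Fˣ} (hJ : ∀ w, pf δ * w = 0 → pf γ * w ∈ J)
    {l : List Fˣ} {b : F} (h : D (pe δ l) b) : Pure J γ l b := by
  induction l generalizing b with
  | nil => exact h
  | cons a l ih =>
    obtain ⟨x, w, hx, hw, rfl⟩ := D_append.1 h
    obtain ⟨y, hy, rfl⟩ := D_map.1 hw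
    refine ⟨x, y, ih hx, ?_, rfl⟩
    by_cases hy0 : y = 0
    · exact Or.inl hy0
    right
    have := round hy hy0
    rw [pf_append] at this
    have h2 := hJ ((1 - br y) * pf l) (by linear_combination -this)
    convert h2 using 1; ring

lemma pureSub0 {l : List Fˣ} {b : F} (hb : b ≠ 0) (h : D (pe [] l) b) :
    ∃ l2 : List Fˣ, l2.length + 1 = l.length ∧ pf l = (1 - br b) * pf l2 := by
  have := pureSub (J := ⊥) (N := l.length) (γ := []) (fun l _ h => by simpa using h) (by simp) hb
    (Pure_of_D (δ := []) (fun w h => by simpa using h) h)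
  simpa using this

lemma pf_two {l m : List Fˣ} {c e : F} (hc : c ≠ 0) (he : e ≠ 0) (h : pf l = br c + br e + cl m)
    (hm : m.length + 2 ≤ 2 ^ l.length) :
    ∃ l2 : List Fˣ, l2.length + 1 = l.length ∧ pf l = (1 - br (-(c * e))) * pf l2 := by
  have h1 : D (ent l) c := D_of_cl (m' := Units.mk0 e he :: m) hc (by rw [cl_ent, h]; simp; ring)
    (by simp [length_ent]; omega)
  have h2 := round h1 hc
  refine pureSub0 (neg_ne_zero.2 (mul_ne_zero hc he)) ?_
  refine D_of_cl (m' := m.map ((- Units.mk0 c hc) * ·)) (neg_ne_zero.2 (mul_ne_zero hc he)) ?_ ?_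
  · rw [cl_pe, cl_map, br_neg, br_mul]
    push_cast
    rw [br_neg, Units.val_mk0]
    have hs := br_sq hc
    rw [pow_two, br_mul] at hs
    simp only [pf_nil]
    linear_combination h2 - br c * h - hs
  · have := length_pe' l
    simp; omega

lemma D_ent_split {l : List Fˣ} {z : F} (h : D (ent l) z) : ∃ u d, D (pe [] l) d ∧ z = u ^ 2 - d := by
  by_cases hz : z = 0
  · exact ⟨0, 0, D_zero _, by simp [hz]⟩
  have : D (1 :: (pe [] l).map ((-1) * ·)) z := by
    refine D_transfer ?_ ?_ hz h
    · rw [cl_cons, cl_map, cl_pe, cl_ent]; simp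
    · have := length_pe' l
      simp [length_ent]; omega
  obtain ⟨s, w, hw, rfl⟩ := this
  obtain ⟨d, hd, rfl⟩ := D_map.1 hw
  exact ⟨s, d, hd, by simp; ring⟩

def Rep2 : List Fˣ → F → F → F → Prop
  | [], α, β, γ => α = 0 ∧ β = 0 ∧ γ = 0
  | c :: m, α, β, γ => ∃ s t α' β' γ', Rep2 m α' β' γ' ∧ α = c * s ^ 2 + α' ∧ β = c * t ^ 2 + β' ∧
      γ = c * (s * t) + γ'

lemma Rep2.comb {m : List Fˣ} {α β γ : F} (h : Rep2 m α β γ) (p q : F) :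
    D m (p ^ 2 * α + 2 * p * q * γ + q ^ 2 * β) := by
  induction m generalizing α β γ with
  | nil => obtain ⟨rfl, rfl, rfl⟩ := h; show _ = _; ring
  | cons c m ih =>
    obtain ⟨s, t, α', β', γ', h, rfl, rfl, rfl⟩ := h
    exact ⟨p * s + q * t, _, ih h, by ring⟩

lemma Rep2.left {m : List Fˣ} {α β γ : F} (h : Rep2 m α β γ) : D m α := by
  simpa using h.comb 1 0

lemma Rep2.right {m : List Fˣ} {α β γ : F} (h : Rep2 m α β γ) : D m β := by
  simpa using h.comb 0 1

lemma Rep2.swap {m : List Fˣ} {α β γ : F} (h : Rep2 m α β γ) : Rep2 m β α γ := by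
  induction m generalizing α β γ with
  | nil => obtain ⟨rfl, rfl, rfl⟩ := h; exact ⟨rfl, rfl, rfl⟩
  | cons c m ih =>
    obtain ⟨s, t, α', β', γ', h, rfl, rfl, rfl⟩ := h
    exact ⟨t, s, _, _, _, ih h, rfl, rfl, by ring⟩

lemma Rep2.ortho {m : List Fˣ} {b v g : F} (h : Rep2 m b v g) (hb : b ≠ 0) :
    ∃ m', cl m = br b + cl m' ∧ m'.length + 1 = m.length ∧ D m' (v - g ^ 2 / b) := by
  induction m generalizing b v g with
  | nil => exact absurd h.1 hb
  | cons c m ih =>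
    obtain ⟨s, t, β, v1, g1, h, hb', rfl, rfl⟩ := h
    have hc := c.ne_zero
    have h2 : (2 : F) ≠ 0 := two_ne_zero
    by_cases hβ : β = 0
    · subst hβ
      have hs : s ≠ 0 := by rintro rfl; simp at hb'; exact hb hb'
      refine ⟨m, ?_, by simp, ?_⟩
      · rw [cl_cons, hb', add_zero, br_mul, br_sq hs]; ring
      · have := h.comb (-g1 / (2 * c * s ^ 2) - t / s) 1
        convert this using 1
        rw [hb']; field_simp; ring
    obtain ⟨m1, e1, e2, e3⟩ := ih h hβ
    by_cases hs : s = 0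
    · subst hs
      have hb2 : b = β := by simpa using hb'
      subst hb2
      refine ⟨c :: m1, by rw [cl_cons, cl_cons, e1]; ring, by simp [e2], t, _, e3, by ring⟩
    have hcs : (c : F) * s ^ 2 ≠ 0 := mul_ne_zero hc (pow_ne_zero _ hs)
    have hd : b * (c * s ^ 2) * β ≠ 0 := mul_ne_zero (mul_ne_zero hb hcs) hβ
    refine ⟨Units.mk0 _ hd :: m1, ?_, by simp [e2], (β * t - s * g1) / (β * b * s), _, e3, ?_⟩
    · rw [cl_cons, cl_cons, Units.val_mk0, e1]
      have h3 := br_bin hcs hβ hb hb'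
      rw [br_mul _ β, br_mul b]
      have h4 : br ((c : F) * s ^ 2) = br (c : F) := by rw [br_mul, br_sq hs, mul_one]
      rw [h4] at h3 ⊢
      linear_combination h3
    · rw [Units.val_mk0]
      field_simp
      rw [hb']; ring

/-- representation over a quadratic extension -/
lemma D_quad {L : Type} [Field L] (f : F →+* L) {δ : L} {d : F} (hd : δ ^ 2 = f d)
    (hspan : ∀ e : L, ∃ x y, e = f x + f y * δ) {m : List Fˣ} {z : L}
    (h : D (m.map (Units.map (f : F →* L))) z) :
    ∃ α β γ, Rep2 m α β γ ∧ z = f (α + d * β) + 2 * f γ * δ := by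
  induction m generalizing z with
  | nil => exact ⟨0, 0, 0, ⟨rfl, rfl, rfl⟩, by have : z = 0 := h; simp [this]⟩
  | cons c m ih =>
    obtain ⟨s, w, hw, rfl⟩ := h
    obtain ⟨α, β, γ, h, rfl⟩ := ih hw
    obtain ⟨x, y, rfl⟩ := hspan s
    refine ⟨_, _, _, ⟨x, y, _, _, _, h, rfl, rfl, rfl⟩, ?_⟩
    simp only [map_add, map_mul, map_pow, Units.coe_map, MonoidHom.coe_coe]
    linear_combination f c * f y ^ 2 * hd

lemma Iso_quad {L : Type} [Field L] (f : F →+* L) {δ : L} {d : F} (hd : δ ^ 2 = f d)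
    (hδ : ∀ x, δ ≠ f x)
    (hspan : ∀ e : L, ∃ x y, e = f x + f y * δ) {m : List Fˣ}
    (h : Iso (m.map (Units.map (f : F →* L)))) :
    Iso m ∨ ∃ α β, Rep2 m α β 0 ∧ α + d * β = 0 ∧ α ≠ 0 := by
  have h2 : (2 : F) ≠ 0 := two_ne_zero
  have h2' : (2 : L) ≠ 0 := by rw [← map_ofNat f 2]; exact (map_ne_zero f).2 h2
  have d0 : d ≠ 0 := by
    rintro rfl
    have : δ = 0 := by simpa using hd
    exact hδ 0 (by simp [this])
  have lin : ∀ x y : F, f x + f y * δ = 0 → x = 0 ∧ y = 0 := by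
    intro x y h
    by_cases hy : y = 0
    · subst hy; simpa using h
    · exfalso
      refine hδ (-x / y) ?_
      have : f y ≠ 0 := (map_ne_zero f).2 hy
      rw [map_div₀, map_neg, eq_div_iff this]; linear_combination h
  induction m with
  | nil => exact absurd h id
  | cons c m ih =>
    rcases h with h | ⟨s, hs, h⟩
    · rcases ih h with h | ⟨α, β, h, h1, h3⟩
      · exact Or.inl (Or.inl h)
      · exact Or.inr ⟨α, β, ⟨0, 0, α, β, 0, h, by simp, by simp, by simp⟩, h1, h3⟩
    · obtain ⟨x, y, rfl⟩ := hspan s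
      obtain ⟨α, β, γ, hr, hz⟩ := D_quad f hd hspan h
      simp only [map_add, map_mul, map_pow, Units.coe_map, MonoidHom.coe_coe] at hz
      have := lin (c * x ^ 2 + α + d * (c * y ^ 2 + β)) (2 * (c * (x * y) + γ)) (by
        simp only [map_add, map_mul, map_pow, map_ofNat]
        linear_combination -hz - f c * f y ^ 2 * hd)
      obtain ⟨e1, e2⟩ := this
      have e3 : c * (x * y) + γ = 0 := (mul_eq_zero.1 e2).resolve_left h2
      have hR : Rep2 (c :: m) (c * x ^ 2 + α) (c * y ^ 2 + β) 0 := ⟨x, y, _, _, _, hr, rfl, rfl, e3.symm⟩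
      by_cases ha : c * x ^ 2 + α = 0
      · left
        have hb : c * y ^ 2 + β = 0 := by
          rw [ha, zero_add] at e1; exact (mul_eq_zero.1 e1).resolve_left d0
        by_cases hx : x = 0
        · have hy : y ≠ 0 := by rintro rfl; simp [hx] at hs
          right
          exact ⟨y, hy, by have := hr.right; rwa [show β = -(c * y ^ 2) by linear_combination hb] at this⟩
        · right
          exact ⟨x, hx, by have := hr.left; rwa [show α = -(c * x ^ 2) by linear_combination ha] at this⟩
      · exact Or.inr ⟨_, _, hR, e1, ha⟩

end pfister
end WT

set_option linter.unusedSectionVars false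
set_option linter.unusedVariables false
set_option linter.unusedSimpArgs false
namespace WT
open Module

section quad
variable {F : Type} [Field F] [NeZero (2 : F)]

def GG (n : ℕ) (E : Type) [Field E] [NeZero (2 : E)] : Prop := ∀ l : List Eˣ, l.length = n + 1 → pf l = 0

/-- the hypothesis that (n+1)-fold Pfister forms vanish over F(i) -/
def PP (n : ℕ) (F : Type) [Field F] : Prop :=
  ∀ (E : Type) [Field E] [NeZero (2 : E)] (f : F →+* E) (i : E), i ^ 2 = -1 →
    (∀ e : E, ∃ x y, e = f x + f y * i) → GG n E

lemma GG.ge {n : ℕ} (h : GG n F) (l : List Fˣ) (hl : n + 1 ≤ l.length) : pf l = 0 := by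
  rw [← List.take_append_drop (n + 1) l, pf_append, h _ (by simpa using hl), zero_mul]

lemma wmap_pf {L : Type} [Field L] [NeZero (2 : L)] (f : F →+* L) (l : List Fˣ) :
    wmap f (pf l) = pf (l.map (Units.map (f : F →* L))) := by
  induction l with
  | nil => simp
  | cons a l ih => simp [ih, wmap_br]

lemma ent_map {L : Type} [Field L] (f : F →+* L) (l : List Fˣ) :
    ent (l.map (Units.map (f : F →* L))) = (ent l).map (Units.map (f : F →* L)) := by
  induction l with
  | nil => simp [ent]
  | cons a l ih =>
    simp [ent, ih, Function.comp_def]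

lemma D_of_round {l : List Fˣ} {b : F} (hb : b ≠ 0) (h : br b * pf l = pf l) : D (ent l) b := by
  obtain ⟨m', e, hl⟩ := cl_of_D (D_ent_one l) one_ne_zero
  refine D_of_cl (m' := m'.map (Units.mk0 b hb * ·)) hb ?_ (by simp; omega)
  rw [cl_map, cl_ent, ← h, ← cl_ent, e, br_one, Units.val_mk0]; ring

lemma br_mul_self {a : F} (ha : a ≠ 0) : br a * br a = 1 := by
  rw [← br_mul, ← pow_two, br_sq ha]

lemma neZero_emb {E : Type} [Field E] (f : F →+* E) : NeZero (2 : E) :=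
  ⟨by rw [← map_ofNat f 2]; exact (map_ne_zero f).2 two_ne_zero⟩

lemma div2_of {n : ℕ} (hn : 1 ≤ n) {E : Type} [Field E] [NeZero (2 : E)] (f : F →+* E) {i : E} (hi : i ^ 2 = -1)
    (hs : ∀ e : E, ∃ x y, e = f x + f y * i) (hni : ∀ x, i ≠ f x) (hG : GG n E)
    (l : List Fˣ) (hl : n + 1 ≤ l.length) : ∃ l' : List Fˣ, l'.length + 1 = l.length ∧ pf l = 2 * pf l' := by
  have h1 : Iso ((ent l).map (Units.map (f : F →* E))) := by
    rw [← ent_map]; exact Iso_of_pf (hG.ge _ (by simpa using hl))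
  rcases Iso_quad f (d := -1) (by simpa using hi) hni hs h1 with h | ⟨α, β, hr, e, hα⟩
  · refine ⟨1 :: List.replicate (l.length - 2) 1, by simp; omega, ?_⟩
    rw [pf_of_Iso h]; simp
  · obtain ⟨m', e1, e2, e3⟩ := hr.ortho hα
    have hβ : β = α := by linear_combination -e
    have e3' : D m' α := by simpa [hβ] using e3
    obtain ⟨m2, e4, e5⟩ := cl_of_D e3' hα
    rw [length_ent] at e2
    obtain ⟨l2, h1, h2⟩ := pf_two (l := l) hα hα (m := m2) (by rw [← cl_ent, e1, e4]; ring) (by omega)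
    refine ⟨l2, h1, ?_⟩
    rw [h2, br_neg, br_mul, br_mul_self hα]; ring

lemma W_aux {l : List Fˣ} {α β γ w : F} (h : Rep2 (ent l) α β γ) (hα : α ≠ 0)
    (hw : w = (α - β) ^ 2 + 4 * γ ^ 2) (hw0 : w ≠ 0) : br w * pf l = pf l := by
  obtain ⟨m', e1, e2, e3⟩ := h.ortho hα
  set β' := β - γ ^ 2 / α with hβ'
  have key : w = (α - β' + γ ^ 2 / α) ^ 2 + α * β' * (2 * γ / α) ^ 2 := by
    rw [hw, hβ']; field_simp; ring
  by_cases hb : β' = 0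
  · rw [hb] at key
    have : w = (α + γ ^ 2 / α) ^ 2 := by rw [key]; ring
    have h0 : α + γ ^ 2 / α ≠ 0 := by rintro h; rw [h] at this; simp at this; exact hw0 this
    rw [this, br_sq h0, one_mul]
  · obtain ⟨m2, e4, e5⟩ := cl_of_D e3 hb
    rw [length_ent] at e2
    obtain ⟨l2, h1, h2⟩ := pf_two (l := l) hα hb (m := m2) (by rw [← cl_ent, e1, e4]; ring) (by omega)
    have hc : -(α * β') ≠ 0 := neg_ne_zero.2 (mul_ne_zero hα hb)
    have hD : D (ent [Units.mk0 _ hc]) w := by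
      refine ⟨α - β' + γ ^ 2 / α, _, ⟨2 * γ / α, 0, rfl, rfl⟩, ?_⟩
      rw [key]; simp
    have := round hD hw0
    simp at this
    rw [h2]
    linear_combination pf l2 * this

lemma W_of {n : ℕ} {E : Type} [Field E] [NeZero (2 : E)] (f : F →+* E) {i : E} (hi : i ^ 2 = -1)
    (hs : ∀ e : E, ∃ x y, e = f x + f y * i) (hni : ∀ x, i ≠ f x) (hG : GG n E)
    (l : List Fˣ) (hl : n ≤ l.length) (x y : F) (hw : x ^ 2 + y ^ 2 ≠ 0) :
    br (x ^ 2 + y ^ 2) * pf l = pf l := by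
  have hb : f x + f y * i ≠ 0 := by
    intro h
    apply hw
    apply f.injective
    simp only [map_add, map_pow, map_zero]
    linear_combination (f x - f y * i) * h + f y ^ 2 * hi
  have h1 := hG.ge (Units.mk0 _ hb :: l.map (Units.map (f : F →* E))) (by simpa using hl)
  rw [pf_cons, Units.val_mk0] at h1
  have h2 : D (ent (l.map (Units.map (f : F →* E)))) (f x + f y * i) :=
    D_of_round hb (by linear_combination -h1)
  rw [ent_map] at h2
  obtain ⟨α, β, γ, hr, e⟩ := D_quad f (d := -1) (by simpa using hi) hs h2
  have e1 : y = 2 * γ := by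
    by_contra hne
    have h3 : f (y - 2 * γ) ≠ 0 := (map_ne_zero f).2 (sub_ne_zero.2 hne)
    refine hni ((α - β - x) / (y - 2 * γ)) ?_
    rw [map_div₀, eq_div_iff h3]
    simp only [map_sub, map_mul, map_ofNat, map_add, map_neg, map_one] at e ⊢
    linear_combination e
  have e2 : x = α - β := by
    apply f.injective
    rw [e1] at e
    simp only [map_sub, map_mul, map_ofNat, map_add, map_neg, map_one] at e ⊢
    linear_combination e
  have hw' : x ^ 2 + y ^ 2 = (α - β) ^ 2 + 4 * γ ^ 2 := by rw [e1, e2]; ring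
  by_cases hα : α = 0
  · by_cases hβ : β = 0
    · rw [hα, hβ] at hw'
      have : x ^ 2 + y ^ 2 = (2 * γ) ^ 2 := by rw [hw']; ring
      have h0 : 2 * γ ≠ 0 := by rintro h; rw [h] at this; simp at this; exact hw this
      rw [this, br_sq h0, one_mul]
    · exact W_aux hr.swap hβ (by rw [hw']; ring) hw
  · exact W_aux hr hα hw' hw

/-- facts extracted about F -/
structure Fa (n : ℕ) (F : Type) [Field F] [NeZero (2 : F)] : Prop where
  div2 : ∀ l : List Fˣ, n + 1 ≤ l.length → ∃ l' : List Fˣ, l'.length + 1 = l.length ∧ pf l = 2 * pf l'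
  hW : ∀ l : List Fˣ, n ≤ l.length → ∀ x y : F, x ^ 2 + y ^ 2 ≠ 0 → br (x ^ 2 + y ^ 2) * pf l = pf l
  ns : ∀ u : F, 1 + u ^ 2 ≠ 0

variable {n : ℕ}

lemma Fa.A (h : Fa n F) (l : List Fˣ) (hl : n + 1 ≤ l.length) (h2 : 2 * pf l = 0) : pf l = 0 := by
  obtain ⟨a, l, rfl⟩ : ∃ a l', l = a :: l' := by
    cases l with
    | nil => simp at hl
    | cons a l => exact ⟨a, l, rfl⟩
  have hl' : n ≤ l.length := by simpa using hl
  rw [pf_cons] at h2 ⊢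
  have hD : D (ent (-1 :: l)) (a : F) := by
    refine D_of_round a.ne_zero ?_
    rw [pf_cons]; simp
    linear_combination -h2
  suffices br (a : F) * pf l = pf l by linear_combination -this
  obtain ⟨x, y', hx, hy', e⟩ := D_append.1 hD
  obtain ⟨y, hy, rfl⟩ := D_map.1 hy'
  simp at e
  by_cases hx0 : x = 0
  · have : (a : F) = y := by rw [e, hx0, zero_add]
    rw [this]; exact round hy (this ▸ a.ne_zero)
  by_cases hy0 : y = 0
  · have : (a : F) = x := by rw [e, hy0, add_zero]
    rw [this]; exact round hx (this ▸ a.ne_zero)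
  have rx := round hx hx0
  have ry := round hy hy0
  have hz0 : y / x ≠ 0 := div_ne_zero hy0 hx0
  have rz : br (y / x) * pf l = pf l := by
    have : br (y / x) * br x = br y := by rw [← br_mul]; congr 1; field_simp
    linear_combination -br (y / x) * rx + pf l * this + ry
  obtain ⟨u, d, hd, ez⟩ := D_ent_split (D_of_round hz0 rz)
  set t := 1 + u ^ 2 with ht
  have ht0 : t ≠ 0 := h.ns u
  have ea : (a : F) = x * (t - d) := by
    have : y = x * (y / x) := by field_simp
    rw [e, this, ez, ht]; ring
  have hs0 : t - d ≠ 0 := by intro h0; rw [h0, mul_zero] at ea; exact a.ne_zero ea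
  have hT : ∀ l : List Fˣ, n ≤ l.length → br t * pf l = pf l := by
    intro l hl
    have := h.hW l hl 1 u (by simpa using ht0)
    simpa [ht] using this
  suffices br (t - d) * pf l = pf l by
    rw [ea, br_mul]; linear_combination br x * this + rx
  by_cases hd0 : d = 0
  · rw [hd0, sub_zero]; exact hT l hl'
  obtain ⟨l2, hl2, e2⟩ := pureSub0 hd0 hd
  have h1 := hT l hl'
  have h3 := hT (Units.mk0 _ (neg_ne_zero.2 hs0) :: l2) (by simp; omega)
  rw [pf_cons, Units.val_mk0, br_neg] at h3
  have hb := br_bin hs0 hd0 ht0 (by ring)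
  rw [e2] at h1 ⊢
  generalize br (t - d) = S at *
  generalize br t = T at *
  generalize br d = D' at *
  linear_combination -(-hb * pf l2 - h3 + S * h1)

lemma pf_replicate (k : ℕ) : pf (List.replicate k (-1 : Fˣ)) = 2 ^ k := by
  induction k with
  | zero => simp
  | succ k ih => rw [List.replicate_succ, pf_cons, ih]; simp; ring

lemma Fa.A2 (h : Fa n F) (l : List Fˣ) (hl : n + 1 ≤ l.length) (k : ℕ) (h2 : 2 ^ k * pf l = 0) : pf l = 0 := by
  induction k with
  | zero => simpa using h2
  | succ k ih =>
    apply ih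
    have := h.A (List.replicate k (-1) ++ l) (by simp; omega) (by rw [pf_append, pf_replicate]; linear_combination h2)
    rwa [pf_append, pf_replicate] at this

lemma cl_rep (m : List Fˣ) (r : ℕ) : cl (List.replicate r m).flatten = r * cl m := by
  induction r with
  | zero => simp
  | succ r ih => rw [List.replicate_succ, List.flatten_cons, cl_append, ih]; push_cast; ring

lemma Fa.tor (h : Fa n F) (l : List Fˣ) (hl : n + 1 ≤ l.length) (m : ℕ) (hm : 0 < m) (h2 : (m : W F) * pf l = 0) :
    pf l = 0 := by
  refine h.A2 l hl m ?_
  have hlt : m ≤ 2 ^ m := (Nat.lt_two_pow_self).le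
  have := pf_of_short (l := List.replicate m (-1) ++ l) (m := (List.replicate (2 ^ m - m) (ent l)).flatten) (by
    rw [pf_append, pf_replicate, cl_rep, cl_ent]
    push_cast [Nat.cast_sub hlt]
    linear_combination h2) (by
    simp [length_ent, pow_add]
    omega)
  rwa [pf_append, pf_replicate] at this

/-- 2-primary torsion -/
def J2 (F : Type) [Field F] [NeZero (2 : F)] : Ideal (W F) where
  carrier := {x | ∃ k : ℕ, 2 ^ k * x = 0}
  add_mem' := by
    rintro a b ⟨k, hk⟩ ⟨j, hj⟩
    exact ⟨k + j, by rw [pow_add]; linear_combination 2 ^ j * hk + 2 ^ k * hj⟩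
  zero_mem' := ⟨0, by simp⟩
  smul_mem' := by
    rintro c x ⟨k, hk⟩
    exact ⟨k, by simp only [smul_eq_mul]; linear_combination c * hk⟩

lemma Fa.U (h : Fa n F) (k : ℕ) {γ l l' : List Fˣ} (hl : γ.length + l.length = n + 1) (hll : l.length = l'.length)
    (e : 2 ^ k * (pf γ * pf l - pf γ * pf l') = 0) : pf γ * pf l = pf γ * pf l' := by
  induction l' generalizing γ l with
  | nil =>
    have : l = [] := List.length_eq_zero_iff.1 hll
    rw [this]
  | cons b l' ih =>
    have hδ : pf (List.replicate k (-1) ++ γ) = 2 ^ k * pf γ := by rw [pf_append, pf_replicate]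
    have hb : D (pe (List.replicate k (-1) ++ γ) l) (b : F) := by
      refine D_transfer (m' := pe (List.replicate k (-1) ++ γ) (b :: l')) ?_ ?_ b.ne_zero ?_
      · rw [cl_pe, cl_pe, hδ]; linear_combination -e
      · rw [length_pe _ _ _ hll]
      · exact D_append.2 ⟨0, b, D_zero _, D_map.2 ⟨1, D_ent_one _, by simp⟩, by simp⟩
    have hP : Pure (J2 F) γ l (b : F) := Pure_of_D (J := J2 F) (γ := γ) (fun w hw => ⟨k, by rw [hδ] at hw; linear_combination hw⟩) hb
    obtain ⟨l2, hl2, e2⟩ := pureSub (J := J2 F) (N := n + 1) (fun l hl ⟨k, hk⟩ => h.A2 l hl.ge k hk) hl b.ne_zero hP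
    have := ih (γ := b :: γ) (l := l2) (by simp at hll ⊢; omega) (by simp at hll; omega) (by
      rw [pf_cons] at e ⊢
      linear_combination e - 2 ^ k * e2)
    rw [pf_cons] at this ⊢
    linear_combination this + e2

end quad
end WT

set_option linter.unusedSectionVars false
set_option linter.unusedVariables false
set_option linter.unusedSimpArgs false
namespace WT
open Module

section torfree
variable {F : Type} [Field F] [NeZero (2 : F)] {n : ℕ}

def Tor (x : W F) : Prop := ∃ m : ℕ, 0 < m ∧ (m : W F) * x = 0

/-- sum of a weighted list -/
noncomputable def ws (L : List (ℤ × List Fˣ × List Fˣ)) : W F := (L.map fun p => (p.1 : W F) * pf p.2.1).sum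

@[simp] lemma ws_nil : ws ([] : List (ℤ × List Fˣ × List Fˣ)) = 0 := rfl
@[simp] lemma ws_cons (p : ℤ × List Fˣ × List Fˣ) (L) : ws (p :: L) = (p.1 : W F) * pf p.2.1 + ws L := by
  simp [ws]

lemma kill (e : W F) (l : List Fˣ)
    (h : ∀ d ∈ l, e * (1 - br (d : F)) = 2 * e ∨ e * (1 - br (d : F)) = 0) :
    e * pf l = 0 ∨ e * pf l = 2 ^ l.length * e := by
  induction l with
  | nil => right; simp
  | cons a l ih =>
    rw [pf_cons]
    rcases ih (fun d hd => h d (List.mem_cons_of_mem _ hd)) with h1 | h1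
    · left; linear_combination (1 - br (a : F)) * h1
    rcases h a List.mem_cons_self with h2 | h2
    · right
      rw [List.length_cons, pow_succ]
      linear_combination pf l * h2 + 2 * h1
    · left; linear_combination pf l * h2

lemma ws_split (h : Fa n F) (d : Fˣ) (L : List (ℤ × List Fˣ × List Fˣ)) (hL : ∀ p ∈ L, p.2.1.length = n + 1) :
    ∃ T : List Fˣ → List Fˣ, (∀ p ∈ L, (T p.2.1).length = n ∧ pf p.2.1 = 2 * pf (T p.2.1)) := by
  classical
  have : ∀ l : List Fˣ, ∃ l' : List Fˣ, l.length = n + 1 → l'.length = n ∧ pf l = 2 * pf l' := by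
    intro l
    by_cases hl : l.length = n + 1
    · obtain ⟨l', h1, h2⟩ := h.div2 l hl.ge
      exact ⟨l', fun _ => ⟨by omega, h2⟩⟩
    · exact ⟨[], fun h => absurd h hl⟩
  choose T hT using this
  exact ⟨T, fun p hp => hT _ (hL p hp)⟩

lemma ws_map (d : Fˣ) (T : List Fˣ → List Fˣ) (L : List (ℤ × List Fˣ × List Fˣ))
    (hT : ∀ p ∈ L, pf p.2.1 = 2 * pf (T p.2.1)) :
    2 * ws (L.map fun p => (p.1, d :: T p.2.1, p.2.2)) = (1 - br (d : F)) * ws L := by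
  induction L with
  | nil => simp
  | cons p L ih =>
    have h1 := hT p List.mem_cons_self
    have h2 := ih fun p hp => hT p (List.mem_cons_of_mem _ hp)
    rw [List.map_cons, ws_cons, ws_cons, pf_cons]
    simp only
    linear_combination h2 - (1 - br (d : F)) * (p.1 : W F) * h1

lemma ws_map_add (d : Fˣ) (T : List Fˣ → List Fˣ) (L : List (ℤ × List Fˣ × List Fˣ))
    (hT : ∀ p ∈ L, pf p.2.1 = 2 * pf (T p.2.1)) :
    ws L = ws (L.map fun p => (p.1, d :: T p.2.1, p.2.2)) + ws (L.map fun p => (p.1, (-d) :: T p.2.1, p.2.2)) := by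
  induction L with
  | nil => simp
  | cons p L ih =>
    have h1 := hT p List.mem_cons_self
    have h2 := ih fun p hp => hT p (List.mem_cons_of_mem _ hp)
    rw [List.map_cons, List.map_cons, ws_cons, ws_cons, ws_cons, pf_cons, pf_cons]
    simp only [Units.val_neg, br_neg]
    linear_combination h2 + (p.1 : W F) * h1

lemma Tor_half {x y c : W F} (h : Tor x) (e : 2 * y = c * x) : Tor y := by
  obtain ⟨m, hm, h⟩ := h
  exact ⟨m * 2, by omega, by push_cast; linear_combination m * e + c * h⟩

lemma ws_const (τ : W F) (L : List (ℤ × List Fˣ × List Fˣ)) (h : ∀ p ∈ L, pf p.2.1 = 0 ∨ pf p.2.1 = τ) :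
    ∃ M : ℤ, ws L = M * τ := by
  induction L with
  | nil => exact ⟨0, by simp⟩
  | cons p L ih =>
    obtain ⟨M, hM⟩ := ih fun p hp => h p (List.mem_cons_of_mem _ hp)
    rw [ws_cons, hM]
    rcases h p List.mem_cons_self with h | h
    · exact ⟨M, by rw [h]; ring⟩
    · exact ⟨M + p.1, by rw [h]; push_cast; ring⟩

lemma Fa.R (h : Fa n F) (Ds : List Fˣ) (k : ℕ) (e : W F) (L : List (ℤ × List Fˣ × List Fˣ))
    (h1 : ∀ p ∈ L, p.2.1.length = n + 1 ∧ p.2.2.length = n + 1 ∧ 2 ^ k * pf p.2.1 = e * pf p.2.2)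
    (h2 : ∀ p ∈ L, ∀ d ∈ p.2.2, d ∈ Ds ∨ e * (1 - br (d : F)) = 2 * e ∨ e * (1 - br (d : F)) = 0)
    (ht : Tor (ws L)) : ws L = 0 := by
  induction Ds generalizing k e L with
  | nil =>
    have hz : ∀ p ∈ L, pf p.2.1 = 0 ∨ 2 ^ k * pf p.2.1 = 2 ^ (n + 1) * e := by
      intro p hp
      obtain ⟨a1, a2, a3⟩ := h1 p hp
      rcases kill e p.2.2 (fun d hd => by simpa using h2 p hp d hd) with h4 | h4
      · left; exact h.A2 _ a1.ge k (a3.trans h4)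
      · right; rw [a3, h4, a2]
    by_cases hall : ∀ p ∈ L, pf p.2.1 = 0
    · obtain ⟨M, hM⟩ := ws_const 0 L fun p hp => Or.inl (hall p hp)
      rw [hM, mul_zero]
    push Not at hall
    obtain ⟨q, hq, hq0⟩ := hall
    have hq2 := (hz q hq).resolve_left hq0
    obtain ⟨M, hM⟩ := ws_const (pf q.2.1) L fun p hp => (hz p hp).imp_right fun h3 => by
      have := h.U k (γ := []) (l := p.2.1) (l' := q.2.1) (by simpa using (h1 p hp).1)
        (by rw [(h1 p hp).1, (h1 q hq).1]) (by simp only [pf_nil]; linear_combination h3 - hq2)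
      simpa using this
    by_cases hM0 : M = 0
    · rw [hM, hM0]; simp
    exfalso
    apply hq0
    obtain ⟨m, hm, e3⟩ := ht
    refine h.tor q.2.1 (h1 q hq).1.ge (m * M.natAbs) (Nat.mul_pos hm (Int.natAbs_pos.2 hM0)) ?_
    rw [hM] at e3
    have h6 : ((M.natAbs : ℕ) : W F) = M ∨ ((M.natAbs : ℕ) : W F) = -M := by
      rcases Int.natAbs_eq M with h5 | h5
      · left; rw [← Int.cast_natCast, ← h5]
      · right; rw [← Int.cast_natCast, ← Int.cast_neg]; congr 1; omega
    rw [Nat.cast_mul]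
    rcases h6 with h6 | h6
    · rw [h6]; linear_combination e3
    · rw [h6]; linear_combination -e3
  | cons d Ds ih =>
    obtain ⟨T, hT⟩ := ws_split h d L fun p hp => (h1 p hp).1
    have hT' : ∀ p ∈ L, pf p.2.1 = 2 * pf (T p.2.1) := fun p hp => (hT p hp).2
    have hdd := br_mul_self d.ne_zero
    have step : ∀ s : Fˣ, (s = d ∨ s = -d) → ws (L.map fun p => (p.1, s :: T p.2.1, p.2.2)) = 0 := by
      intro s hs
      apply ih (k + 1) (e * (1 - br (s : F)))
      · intro p' hp'
        obtain ⟨p, hp, rfl⟩ := List.mem_map.1 hp'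
        obtain ⟨a1, a2, a3⟩ := h1 p hp
        refine ⟨by simp [(hT p hp).1], a2, ?_⟩
        have := hT' p hp
        rw [pf_cons, pow_succ]
        simp only
        linear_combination (1 - br (s : F)) * a3 - 2 ^ k * (1 - br (s : F)) * this
      · intro p' hp'
        obtain ⟨p, hp, rfl⟩ := List.mem_map.1 hp'
        intro c hc
        rcases h2 p hp c hc with h3 | h3 | h3
        · rcases List.mem_cons.1 h3 with rfl | h3
          · right
            rcases hs with rfl | rfl
            · left; linear_combination e * hdd
            · right; simp only [Units.val_neg, br_neg]; linear_combination -e * hdd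
          · exact Or.inl h3
        · right; left; linear_combination (1 - br (s : F)) * h3
        · right; right; linear_combination (1 - br (s : F)) * h3
      · exact Tor_half ht (ws_map s T L hT')
    rw [ws_map_add d T L hT', step d (Or.inl rfl), step (-d) (Or.inr rfl), add_zero]

/-- powers of the fundamental ideal -/
noncomputable def IP (k : ℕ) (F : Type) [Field F] [NeZero (2 : F)] : AddSubgroup (W F) :=
  AddSubgroup.closure {x | ∃ (c : Fˣ) (l : List Fˣ), l.length = k ∧ x = br (c : F) * pf l}

lemma Fa.exists_ws (h : Fa n F) {x : W F} (hx : x ∈ IP (n + 1) F) :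
    ∃ L : List (ℤ × List Fˣ × List Fˣ), (∀ p ∈ L, p.2.1.length = n + 1 ∧ p.2.2 = p.2.1) ∧ x = ws L := by
  induction hx using AddSubgroup.closure_induction with
  | mem x hx =>
    obtain ⟨c, l, hl, rfl⟩ := hx
    obtain ⟨l2, h2, e2⟩ := h.div2 (c :: l) (by simp [hl])
    refine ⟨[(1, l, l), (-2, l2, l2)], ?_, ?_⟩
    · have : l2.length = n + 1 := by simp [hl] at h2; omega
      simp [hl, this]
    · rw [pf_cons] at e2
      simp
      linear_combination -e2
  | zero => exact ⟨[], by simp, rfl⟩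
  | add x y _ _ hx hy =>
    obtain ⟨L, h1, rfl⟩ := hx
    obtain ⟨L', h1', rfl⟩ := hy
    refine ⟨L ++ L', ?_, by simp [ws]⟩
    intro p hp
    rcases List.mem_append.1 hp with hp | hp
    · exact h1 p hp
    · exact h1' p hp
  | neg x hx0 hx =>
    obtain ⟨L, h1, rfl⟩ := hx
    clear hx0
    refine ⟨L.map fun p => (-p.1, p.2), ?_, ?_⟩
    · intro p' hp'
      obtain ⟨p, hp, rfl⟩ := List.mem_map.1 hp'
      exact h1 p hp
    · clear h1
      induction L with
      | nil => simp
      | cons p L ih => rw [List.map_cons, ws_cons, ws_cons, ← ih]; push_cast; ring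

lemma Fa.torfree (h : Fa n F) {x : W F} (hx : x ∈ IP (n + 1) F) (ht : Tor x) : x = 0 := by
  obtain ⟨L, h1, rfl⟩ := h.exists_ws hx
  refine h.R (L.map fun p => p.2.2).flatten 0 1 L ?_ ?_ ht
  · intro p hp
    obtain ⟨a, b⟩ := h1 p hp
    exact ⟨a, by rw [b, a], by rw [b]; simp⟩
  · intro p hp d hd
    left
    exact List.mem_flatten.2 ⟨_, List.mem_map.2 ⟨p, hp, rfl⟩, hd⟩

lemma IP_mul {k : ℕ} {x : W F} (hx : x ∈ IP k F) (a : Fˣ) : (1 - br (a : F)) * x ∈ IP (k + 1) F := by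
  induction hx using AddSubgroup.closure_induction with
  | mem x hx =>
    obtain ⟨c, l, hl, rfl⟩ := hx
    exact AddSubgroup.subset_closure ⟨c, a :: l, by simp [hl], by rw [pf_cons]; ring⟩
  | zero => simp [zero_mem]
  | add x y _ _ hx hy => rw [mul_add]; exact add_mem hx hy
  | neg x _ hx => rw [mul_neg]; exact neg_mem hx

lemma GG.torfree (h : GG n F) {x : W F} (hx : x ∈ IP (n + 1) F) : x = 0 := by
  induction hx using AddSubgroup.closure_induction with
  | mem x hx => obtain ⟨c, l, hl, rfl⟩ := hx; rw [h l hl, mul_zero]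
  | zero => rfl
  | add x y _ _ hx hy => rw [hx, hy, add_zero]
  | neg x _ hx => rw [hx, neg_zero]

/-- quadratic extension data -/
lemma fact_of {d : F} (hd : ∀ x : F, x ^ 2 ≠ d) : Fact (∀ r : F, r ^ 2 ≠ d + 0 * r) :=
  ⟨fun r h => hd r (by simpa using h)⟩

lemma PP.cases (hn : 1 ≤ n) (h : PP n F) : GG n F ∨ Fa n F := by
  by_cases hs : ∃ i : F, i ^ 2 = -1
  · obtain ⟨i, hi⟩ := hs
    exact Or.inl (h F (RingHom.id F) i hi fun e => ⟨e, 0, by simp⟩)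
  · right
    push Not at hs
    have := fact_of hs
    let f : F →+* QuadraticAlgebra F (-1) 0 := algebraMap _ _
    have : NeZero (2 : QuadraticAlgebra F (-1) 0) := neZero_emb f
    have hi : (QuadraticAlgebra.omega : QuadraticAlgebra F (-1) 0) ^ 2 = -1 := by
      rw [pow_two, QuadraticAlgebra.omega_mul_omega_eq_algebraMap]; simp
    have hsp : ∀ e : QuadraticAlgebra F (-1) 0, ∃ x y, e = f x + f y * QuadraticAlgebra.omega := fun e =>
      ⟨e.re, e.im, by ext <;> simp [f]⟩
    have hni : ∀ x, (QuadraticAlgebra.omega : QuadraticAlgebra F (-1) 0) ≠ f x := fun x hx => by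
      have := congrArg QuadraticAlgebra.im hx
      simp [f] at this
    have hG := h _ f _ hi hsp
    exact ⟨fun l hl => div2_of hn f hi hsp hni hG l hl, fun l hl => W_of f hi hsp hni hG l hl,
      fun u hu => hs u (by linear_combination hu)⟩

theorem PP.main (hn : 1 ≤ n) (h : PP n F) {x : W F} (hx : x ∈ IP n F) (ht : Tor x) {a : F} (ha : a ≠ 0) :
    br a * x = x := by
  have h1 := IP_mul hx (Units.mk0 a ha)
  rw [Units.val_mk0] at h1
  have : (1 - br a) * x = 0 := by
    rcases h.cases hn with h | h
    · exact h.torfree h1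
    · refine h.torfree h1 ?_
      obtain ⟨m, hm, e⟩ := ht
      exact ⟨m, hm, by linear_combination (1 - br a) * e⟩
  linear_combination -this

end torfree
end WT

set_option linter.unusedSectionVars false
set_option linter.unusedVariables false
set_option linter.unusedSimpArgs false
namespace WT
open Module

section ascent
variable {E : Type} [Field E] [NeZero (2 : E)] {n : ℕ}

lemma Rep2_of {m : List Eˣ} {α β : E} (h : D m α) (h' : D m β) : ∃ γ, Rep2 m α β γ := by
  induction m generalizing α β with
  | nil => exact ⟨0, h, h', rfl⟩
  | cons c m ih =>
    obtain ⟨s, z, hz, rfl⟩ := h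
    obtain ⟨t, w, hw, rfl⟩ := h'
    obtain ⟨γ, hγ⟩ := ih hz hw
    exact ⟨_, s, t, _, _, γ, hγ, rfl, rfl, rfl⟩

lemma Rep2_D {L : Type} [Field L] (f : E →+* L) {m : List Eˣ} {α β γ : E} (h : Rep2 m α β γ) (p q : L) :
    D (m.map (Units.map (f : E →* L))) (p ^ 2 * f α + 2 * p * q * f γ + q ^ 2 * f β) := by
  induction m generalizing α β γ with
  | nil => obtain ⟨rfl, rfl, rfl⟩ := h; show _ = _; simp
  | cons c m ih =>
    obtain ⟨s, t, α', β', γ', h, rfl, rfl, rfl⟩ := h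
    refine ⟨p * f s + q * f t, _, ih h, ?_⟩
    simp only [map_add, map_mul, map_pow, Units.coe_map, MonoidHom.coe_coe]
    ring

lemma step5a {L : Type} [Field L] [NeZero (2 : L)] (g : E →+* L) {δ : L} {d : E} (hd : δ ^ 2 = g d)
    (hδ : ∀ x, δ ≠ g x) (hspan : ∀ e : L, ∃ x y, e = g x + g y * δ) (hG : GG n E)
    (l : List Eˣ) (hl : l.length = n) (b : L) (hb : b ≠ 0) :
    br b * pf (l.map (Units.map (g : E →* L))) = pf (l.map (Units.map (g : E →* L))) := by
  have base : ∀ a : E, a ≠ 0 → br (g a) * pf (l.map (Units.map (g : E →* L))) = pf (l.map (Units.map (g : E →* L))) := by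
    intro a ha
    have h1 := hG (Units.mk0 a ha :: l) (by simp [hl])
    have h2 := congrArg (wmap g) h1
    rw [pf_cons, map_mul, map_sub, map_one, wmap_br, wmap_pf, map_zero, Units.val_mk0] at h2
    linear_combination -h2
  obtain ⟨u, v, rfl⟩ := hspan b
  by_cases hv : v = 0
  · subst hv
    simp only [map_zero, zero_mul, add_zero] at hb ⊢
    exact base u (by rintro rfl; simp at hb)
  have d0 : d ≠ 0 := by
    rintro rfl
    have : δ = 0 := by simpa using hd
    exact hδ 0 (by simp [this])
  have hN : u ^ 2 - d * v ^ 2 ≠ 0 := by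
    intro h0
    have h1 : (g u + g v * δ) * (g u - g v * δ) = 0 := by
      have := congrArg g h0
      simp only [map_sub, map_mul, map_pow, map_zero] at this
      linear_combination this - g v ^ 2 * hd
    have h2 := (mul_eq_zero.1 h1).resolve_left hb
    refine hδ (u / v) ?_
    rw [map_div₀, eq_div_iff ((map_ne_zero g).2 hv)]
    linear_combination -h2
  have hr : br (u ^ 2 - d * v ^ 2) * pf l = pf l := by
    have h1 := hG (Units.mk0 _ hN :: l) (by simp [hl])
    rw [pf_cons, Units.val_mk0] at h1
    linear_combination -h1
  obtain ⟨g0, hR⟩ := Rep2_of (D_of_round hN hr) (D_ent_one l)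
  by_cases hc : 2 * (u - g0) = 0
  · have hg0 : g0 = u := by
      have := (mul_eq_zero.1 hc).resolve_left two_ne_zero
      linear_combination -this
    rw [hg0] at hR
    obtain ⟨m', e1, e2, e3⟩ := hR.swap.ortho one_ne_zero
    have e3' : D m' (-(d * v ^ 2)) := by
      convert e3 using 1; ring
    obtain ⟨m2, e4, e5⟩ := cl_of_D e3' (neg_ne_zero.2 (mul_ne_zero d0 (pow_ne_zero _ hv)))
    rw [length_ent] at e2
    have h0 : pf (l.map (Units.map (g : E →* L))) = 0 := by
      refine pf_of_short (m := m2.map (Units.map (g : E →* L))) ?_ ?_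
      · rw [← wmap_pf, ← wmap_cl, ← cl_ent, e1, e4]
        simp only [map_add, wmap_br, br_neg, map_neg, br_mul, map_mul, map_one, br_one, ← hd, map_pow]
        rw [br_sq, br_sq]
        · ring
        · exact (map_ne_zero g).2 hv
        · rintro rfl
          exact hδ 0 (by simp)
      · simp; omega
    rw [h0, mul_zero]
  · have hc' : g (2 * (u - g0)) ≠ 0 := (map_ne_zero g).2 hc
    have hD := Rep2_D g hR 1 (-(g u + g v * δ))
    rw [← ent_map] at hD
    have e : (1 : L) ^ 2 * g (u ^ 2 - d * v ^ 2) + 2 * 1 * (-(g u + g v * δ)) * g g0 + (-(g u + g v * δ)) ^ 2 * g 1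
        = (g u + g v * δ) * g (2 * (u - g0)) := by
      simp only [map_sub, map_mul, map_pow, map_ofNat, map_one]
      linear_combination g v ^ 2 * hd
    rw [e] at hD
    have h1 := round hD (mul_ne_zero hb hc')
    have h2 := base _ hc
    rw [br_mul] at h1
    linear_combination h1 - br (g u + g v * δ) * h2

lemma step5b {L : Type} [Field L] [NeZero (2 : L)] (g : E →+* L) {δ : L}
    (hspan : ∀ e : L, ∃ x y, e = g x + g y * δ) (x : W L)
    (h : ∀ a : E, a ≠ 0 → ∀ b : L, b ≠ 0 → br (g a) * ((1 - br b) * x) = (1 - br b) * x)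
    (b1 b2 : L) (h1 : b1 ≠ 0) (h2 : b2 ≠ 0) : (1 - br b1) * ((1 - br b2) * x) = 0 := by
  have sc : ∀ s t : E, s ≠ 0 → t ≠ 0 →
      (1 - br b1) * ((1 - br b2) * x) = (1 - br (g s * b1)) * ((1 - br (g t * b2)) * x) := by
    intro s t hs ht
    have e1 := h s hs b2 h2
    have e2 := h t ht (g s * b1) (mul_ne_zero ((map_ne_zero g).2 hs) h1)
    rw [br_mul (g s)] at e2
    rw [br_mul, br_mul]
    linear_combination br b1 * e1 + br b2 * e2
  obtain ⟨u1, v1, e1⟩ := hspan b1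
  obtain ⟨u2, v2, e2⟩ := hspan b2
  by_cases hv1 : v1 = 0
  · have : b1 = g u1 := by rw [e1, hv1]; simp
    have hu : u1 ≠ 0 := by rintro rfl; simp at this; exact h1 this
    rw [this]; linear_combination -h u1 hu b2 h2
  by_cases hv2 : v2 = 0
  · have : b2 = g u2 := by rw [e2, hv2]; simp
    have hu : u2 ≠ 0 := by rintro rfl; simp at this; exact h2 this
    rw [this]; linear_combination -h u2 hu b1 h1
  by_cases hw : v2 * u1 - v1 * u2 = 0
  · rw [sc v2 (-v1) hv2 (neg_ne_zero.2 hv1)]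
    have : g (-v1) * b2 = -(g v2 * b1) := by
      have := congrArg g hw
      simp only [map_sub, map_mul, map_zero] at this
      rw [e1, e2, map_neg]; linear_combination this
    rw [this, br_neg]
    have hs := br_mul_self (mul_ne_zero ((map_ne_zero g).2 hv2) h1)
    linear_combination -x * hs
  · have hw' := (map_ne_zero g).2 hw
    have hs : v2 / (v2 * u1 - v1 * u2) ≠ 0 := div_ne_zero hv2 hw
    have ht : -v1 / (v2 * u1 - v1 * u2) ≠ 0 := div_ne_zero (neg_ne_zero.2 hv1) hw
    rw [sc _ _ hs ht]
    have := br_bin (mul_ne_zero ((map_ne_zero g).2 hs) h1) (mul_ne_zero ((map_ne_zero g).2 ht) h2)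
      one_ne_zero (by
        rw [map_div₀, map_div₀, div_mul_eq_mul_div, div_mul_eq_mul_div, ← add_div, eq_comm, div_eq_one_iff_eq hw', e1, e2]
        simp only [map_sub, map_mul, map_neg]; ring)
    rw [br_one] at this
    linear_combination -x * this

lemma step5 {L : Type} [Field L] [NeZero (2 : L)] (g : E →+* L) {δ : L} {d : E} (hd : δ ^ 2 = g d)
    (hspan : ∀ e : L, ∃ x y, e = g x + g y * δ) (hG : GG n E) : GG n L := by
  by_cases hδ : ∃ x, δ = g x
  · obtain ⟨x0, rfl⟩ := hδ
    have hsurj : Function.Surjective (Units.map (g : E →* L)) := by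
      intro e
      obtain ⟨x, y, h⟩ := hspan e
      have h' : (e : L) = g (x + y * x0) := by rw [h, map_add, map_mul]
      have h0 : x + y * x0 ≠ 0 := by intro h0; rw [h0, map_zero] at h'; exact e.ne_zero h'
      exact ⟨Units.mk0 _ h0, by ext; simp [h']⟩
    intro l hl
    obtain ⟨l0, rfl⟩ := List.map_surjective_iff.2 hsurj l
    rw [← wmap_pf, hG l0 (by simpa using hl), map_zero]
  push Not at hδ
  have key : ∀ k : ℕ, ∀ (l : List Eˣ) (l' : List Lˣ), l'.length = k → l.length + k = n + 1 →
      pf (l.map (Units.map (g : E →* L))) * pf l' = 0 := by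
    intro k
    induction k with
    | zero =>
      intro l l' h1 h2
      rw [← wmap_pf, hG l h2, map_zero, zero_mul]
    | succ k ih =>
      intro l l' h1 h2
      rcases l' with _ | ⟨b1, _ | ⟨b2, l'⟩⟩
      · simp at h1
      · have := step5a g hd hδ hspan hG l (by simp at h1; omega) b1 b1.ne_zero
        rw [pf_cons, pf_nil]
        linear_combination -this
      · simp at h1
        have := step5b g hspan (pf (l.map (Units.map (g : E →* L))) * pf l') (by
          intro a ha b hb
          have h3 := ih (Units.mk0 a ha :: l) (Units.mk0 b hb :: l') (by simp; omega) (by simp; omega)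
          rw [List.map_cons, pf_cons, pf_cons] at h3
          simp only [Units.coe_map, MonoidHom.coe_coe, Units.val_mk0] at h3
          linear_combination -h3) b1 b2 b1.ne_zero b2.ne_zero
        rw [pf_cons, pf_cons]
        linear_combination this
  intro l hl
  simpa using key (n + 1) [] l hl (by simp)

lemma PP.up {F F1 : Type} [Field F] [NeZero (2 : F)] [Field F1] (f : F →+* F1) {δ : F1} {d : F} (hd : δ ^ 2 = f d)
    (hspan : ∀ e : F1, ∃ x y, e = f x + f y * δ) (h : PP n F) : PP n F1 := by
  intro E1 _ _ f1 i hi hs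
  by_cases hsq : ∃ x : F, x ^ 2 = -1
  · obtain ⟨x0, hx0⟩ := hsq
    have hG : GG n F := h F (RingHom.id F) x0 hx0 fun e => ⟨e, 0, by simp⟩
    refine step5 (f1.comp f) (δ := f1 δ) (d := d) (by simp [← hd]) ?_ hG
    have hi2 : i = f1 (f x0) ∨ i = -f1 (f x0) := by
      apply sq_eq_sq_iff_eq_or_eq_neg.1
      rw [hi, ← map_pow, ← map_pow, hx0]; simp
    have hx : ∃ x1 : F, i = f1 (f x1) := by
      rcases hi2 with h | h
      · exact ⟨x0, h⟩
      · exact ⟨-x0, by simp [h]⟩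
    obtain ⟨x1, rfl⟩ := hx
    intro e
    obtain ⟨x, y, rfl⟩ := hs e
    obtain ⟨a, b, rfl⟩ := hspan x
    obtain ⟨p, q, rfl⟩ := hspan y
    refine ⟨a + p * x1, b + q * x1, ?_⟩
    simp only [RingHom.comp_apply, map_add, map_mul]; ring
  · push Not at hsq
    have := fact_of hsq
    let j : F →+* QuadraticAlgebra F (-1) 0 := algebraMap _ _
    have : NeZero (2 : QuadraticAlgebra F (-1) 0) := neZero_emb j
    have hj : (QuadraticAlgebra.omega : QuadraticAlgebra F (-1) 0) ^ 2 = -1 := by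
      rw [pow_two, QuadraticAlgebra.omega_mul_omega_eq_algebraMap]; simp
    have hsp : ∀ e : QuadraticAlgebra F (-1) 0, ∃ x y, e = j x + j y * QuadraticAlgebra.omega := fun e =>
      ⟨e.re, e.im, by ext <;> simp [j]⟩
    have hG := h _ j _ hj hsp
    have hlift : ∃ g : QuadraticAlgebra F (-1) 0 →+* E1, (∀ x, g (j x) = f1 (f x)) ∧ g QuadraticAlgebra.omega = i := by
      let _ : Algebra F E1 := (f1.comp f).toAlgebra
      let g := QuadraticAlgebra.lift (R := F) (A := E1) (a := -1) (b := 0) ⟨i, by rw [← pow_two, hi]; simp⟩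
      refine ⟨g.toRingHom, fun x => ?_, ?_⟩
      · exact g.commutes x
      · simp [g]
    obtain ⟨g, hg1, hg2⟩ := hlift
    refine step5 g (δ := f1 δ) (d := j d) (by rw [hg1, ← hd, map_pow]) ?_ hG
    intro e
    obtain ⟨x, y, rfl⟩ := hs e
    obtain ⟨a, b, rfl⟩ := hspan x
    obtain ⟨p, q, rfl⟩ := hspan y
    refine ⟨j a + j p * QuadraticAlgebra.omega, j b + j q * QuadraticAlgebra.omega, ?_⟩
    simp only [map_add, map_mul, hg1, hg2]; ring

end ascent
end WT

set_option linter.unusedSectionVars false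
set_option linter.unusedVariables false
set_option linter.unusedSimpArgs false
namespace WT
open Module

section final

lemma two_refl (F : Type) [Field F] : IsTwoExtension F F := by
  refine ⟨inferInstance, 0, fun _ => ⊥, rfl, ?_, fun i => i.elim0⟩
  exact Subsingleton.elim _ _

lemma two_tower (K F1 L : Type) [Field K] [Field F1] [Field L] [Algebra K F1] [Algebra F1 L] [Algebra K L]
    [IsScalarTower K F1 L] (h2 : finrank K F1 = 2) (h : IsTwoExtension F1 L) : IsTwoExtension K L := by
  obtain ⟨hf, n, G, h0, h1, hs⟩ := h
  have : FiniteDimensional K F1 := FiniteDimensional.of_finrank_pos (by omega)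
  refine ⟨FiniteDimensional.trans K F1 L, n + 1,
    Fin.cons ⊥ (fun i => (G i).restrictScalars K), by simp, ?_, ?_⟩
  · rw [← Fin.succ_last, Fin.cons_succ, h1]; rfl
  · intro i
    refine Fin.cases ?_ (fun i => ?_) i
    · refine ⟨by simp, ?_⟩
      rw [Fin.cons_succ, Fin.castSucc_zero, Fin.cons_zero, h0, IntermediateField.relfinrank_bot_left, ← h2]
      refine LinearEquiv.finrank_eq ?_
      exact ((IntermediateField.botEquiv F1 L).restrictScalars K).toLinearEquiv
    · rw [← Fin.succ_castSucc, Fin.cons_succ, Fin.cons_succ]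
      exact hs i

lemma norm_quad {F : Type} [Field F] (d : F) (z : QuadraticAlgebra F d 0) :
    Algebra.norm F z = z.re ^ 2 - d * z.im ^ 2 := by
  have : Algebra.norm F z = z.norm := by
    rw [← QuadraticAlgebra.det_toLinearMap_eq_norm]; rfl
  rw [this, QuadraticAlgebra.norm_def]; ring

variable {F L : Type} [Field F] [NeZero (2 : F)] [Field L] [NeZero (2 : L)]

lemma IP_map (f : F →+* L) {k : ℕ} {x : W F} (h : x ∈ IP k F) : wmap f x ∈ IP k L := by
  induction h using AddSubgroup.closure_induction with
  | mem x hx =>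
    obtain ⟨c, l, hl, rfl⟩ := hx
    apply AddSubgroup.subset_closure
    refine ⟨Units.map (f : F →* L) c, l.map (Units.map (f : F →* L)), by simpa, ?_⟩
    rw [map_mul, wmap_br, wmap_pf]; rfl
  | zero => rw [map_zero]; exact zero_mem _
  | add x y _ _ hx hy => rw [map_add]; exact add_mem hx hy
  | neg x _ hx => rw [map_neg]; exact neg_mem hx

lemma Tor_map (f : F →+* L) {x : W F} (h : Tor x) : Tor (wmap f x) := by
  obtain ⟨m, hm, h⟩ := h
  refine ⟨m, hm, ?_⟩
  have := congrArg (wmap f) h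
  simpa using this

lemma IP_even {k : ℕ} (hk : 1 ≤ k) {x : W F} (h : x ∈ IP k F) : ∃ m : List Fˣ, Even m.length ∧ x = cl m := by
  induction h using AddSubgroup.closure_induction with
  | mem x hx =>
    obtain ⟨c, l, hl, rfl⟩ := hx
    refine ⟨(ent l).map (c * ·), ?_, ?_⟩
    · rw [List.length_map, length_ent, hl]
      exact (Nat.even_pow.2 ⟨even_two, by omega⟩)
    · rw [cl_map, cl_ent]
  | zero => exact ⟨[], by simp, by simp⟩
  | add x y _ _ hx hy =>
    obtain ⟨a, ha, rfl⟩ := hx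
    obtain ⟨b, hb, rfl⟩ := hy
    exact ⟨a ++ b, by simpa using ha.add hb, by simp⟩
  | neg x _ hx =>
    obtain ⟨a, ha, rfl⟩ := hx
    refine ⟨a.map ((-1 : Fˣ) * ·), by simpa using ha, ?_⟩
    rw [cl_map]; simp [br_neg, br_one]

lemma IP_len {k : ℕ} (hk : 1 ≤ k) {m : List Fˣ} (h : cl m ∈ IP k F) : Even m.length := by
  obtain ⟨m', h1, h2⟩ := IP_even hk h
  have := even_of_cl h2
  exact (Nat.even_add.1 this).2 h1

end final
end WT

set_option linter.unusedSectionVars false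
set_option linter.unusedVariables false
set_option linter.unusedSimpArgs false
namespace WT
open Module

section final2

lemma wmap_comp {F L M : Type} [Field F] [NeZero (2 : F)] [Field L] [NeZero (2 : L)] [Field M] [NeZero (2 : M)]
    (f : F →+* L) (g : L →+* M) (m : List Fˣ) : wmap g (wmap f (cl m)) = wmap (g.comp f) (cl m) := by
  rw [wmap_cl, wmap_cl, wmap_cl, List.map_map]; rfl

theorem splitting {n : ℕ} (hn : 1 ≤ n) (N : ℕ) : ∀ (F : Type) [Field F] [NeZero (2 : F)] (m : List Fˣ) (a : F),
    m.length = N → PP n F → cl m ∈ IP n F → Tor (cl m) → a ≠ 0 →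
    ∃ L : FieldExt F, IsTwoExtension F L.carrier ∧
      (∀ [NeZero (2 : L.carrier)], wmap (algebraMap F L.carrier) (cl m) = 0) ∧ a ∈ normSet F L.carrier := by
  induction N using Nat.strong_induction_on with
  | _ N ih =>
  intro F _ _ m a hm hP hI hT ha
  by_cases hiso : Iso m
  · obtain ⟨m', h1, h2⟩ := cl_of_Iso hiso
    rw [h1] at hI hT ⊢
    exact ih m'.length (by omega) F m' a rfl hP hI hT ha
  cases m with
  | nil =>
    refine ⟨⟨F⟩, two_refl F, ?_, ?_⟩
    · intro _; simp
    · exact ⟨a, ha, by simp⟩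
  | cons m1 m' =>
    have hmain := hP.main hn hI hT ha
    have hD : D (m1 :: m') (a * m1) := by
      refine D_of_cl (mul_ne_zero ha m1.ne_zero) (m' := m'.map (Units.mk0 a ha * ·)) ?_ (by simp)
      rw [cl_map, Units.val_mk0, ← hmain, cl_cons, br_mul]; ring
    have hev := IP_len hn hI
    have hts : ∃ t y s : F, t ≠ 0 ∧ D m' t ∧ a * m1 = m1 * y ^ 2 + t * s ^ 2 := by
      obtain ⟨y, t, ht, e⟩ := hD
      by_cases h0 : t = 0
      · subst h0
        cases m' with
        | nil => simp at hev
        | cons m2 m'' =>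
          exact ⟨m2, y, 0, m2.ne_zero, D_mem (by simp), by rw [e]; ring⟩
      · exact ⟨t, y, 1, h0, ht, by rw [e]; ring⟩
    obtain ⟨t, y, s, ht, hDt, e⟩ := hts
    have hm1 : (m1 : F) ≠ 0 := m1.ne_zero
    obtain ⟨d, hd⟩ : ∃ d : F, d = -t / m1 := ⟨_, rfl⟩
    have hd1 : (m1 : F) * d = -t := by rw [hd]; field_simp
    have hns : ∀ x : F, x ^ 2 ≠ d := by
      intro x hx
      apply hiso
      refine Or.inr ⟨x, ?_, ?_⟩
      · rintro rfl
        rw [← hx] at hd1; apply ht; linear_combination hd1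
      · rw [hx, hd1, neg_neg]; exact hDt
    have := fact_of hns
    let f : F →+* QuadraticAlgebra F d 0 := algebraMap _ _
    have : NeZero (2 : QuadraticAlgebra F d 0) := neZero_emb f
    have hw : (QuadraticAlgebra.omega : QuadraticAlgebra F d 0) ^ 2 = f d := by
      rw [pow_two, QuadraticAlgebra.omega_mul_omega_eq_algebraMap]; simp [f]
    have hsp : ∀ e : QuadraticAlgebra F d 0, ∃ x y, e = f x + f y * QuadraticAlgebra.omega := fun e =>
      ⟨e.re, e.im, by ext <;> simp [f]⟩
    have hP1 : PP n (QuadraticAlgebra F d 0) := hP.up f hw hsp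
    have hI1 := IP_map f hI
    have hT1 := Tor_map f hT
    have hd0 : d ≠ 0 := fun h => hns 0 (by simp [h])
    have hw0 : (QuadraticAlgebra.omega : QuadraticAlgebra F d 0) ≠ 0 := by
      intro h; rw [h] at hw
      apply (map_ne_zero f).2 hd0; rw [← hw]; simp
    have hiso1 : Iso ((m1 :: m').map (Units.map (f : F →* QuadraticAlgebra F d 0))) := by
      refine Or.inr ⟨_, hw0, ?_⟩
      have h1 := D_emb f hDt
      have h2 : f t = -(((Units.map (f : F →* QuadraticAlgebra F d 0)) m1 : (QuadraticAlgebra F d 0)ˣ) *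
          (QuadraticAlgebra.omega : QuadraticAlgebra F d 0) ^ 2) := by
        have : (((Units.map (f : F →* QuadraticAlgebra F d 0)) m1 : (QuadraticAlgebra F d 0)ˣ) : QuadraticAlgebra F d 0)
          = f m1 := rfl
        rw [this, hw, ← map_mul, hd1, map_neg, neg_neg]
      rw [h2] at h1
      exact h1
    obtain ⟨m2, h1, h2⟩ := cl_of_Iso hiso1
    rw [← wmap_cl] at h1
    let z : QuadraticAlgebra F d 0 := ⟨y, s⟩
    have hz : Algebra.norm F z = a := by
      rw [norm_quad]
      show y ^ 2 - d * s ^ 2 = a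
      apply mul_left_cancel₀ hm1
      linear_combination -e - s ^ 2 * hd1
    have hz0 : z ≠ 0 := by
      intro h
      rw [h, norm_quad] at hz
      apply ha; rw [← hz]; simp
    obtain ⟨⟨L⟩, hL1, hL2, w, hw1, hw2⟩ := ih m2.length (by rw [List.length_map] at h2; omega) _ m2 z rfl hP1 (h1 ▸ hI1) (h1 ▸ hT1) hz0
    dsimp only at hL1 hL2 w hw1 hw2
    let _ : Algebra F L := ((algebraMap (QuadraticAlgebra F d 0) L).comp f).toAlgebra
    have _ : IsScalarTower F (QuadraticAlgebra F d 0) L := IsScalarTower.of_algebraMap_eq fun x => rfl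
    have h2 : finrank F (QuadraticAlgebra F d 0) = 2 := QuadraticAlgebra.finrank_eq_two _ _
    refine ⟨⟨L⟩, two_tower F (QuadraticAlgebra F d 0) L h2 hL1, ?_, ?_⟩
    · intro hn2
      have hn2' : NeZero (2 : L) := hn2
      have h3 := hL2
      rw [← h1, wmap_comp] at h3
      exact h3
    · refine ⟨w, hw1, ?_⟩
      have := hL1.1
      have _ : FiniteDimensional F (QuadraticAlgebra F d 0) := FiniteDimensional.of_finrank_pos (by omega)
      have h4 := Algebra.norm_norm (R := F) (S := QuadraticAlgebra F d 0) (a := w)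
      rw [hw2, hz] at h4
      exact h4.symm

end final2
end WT

set_option linter.unusedSectionVars false
set_option linter.unusedVariables false
set_option linter.unusedSimpArgs false
namespace WT
open Module

section concl

lemma ND_of_nondeg {F : Type} [Field F] {φ : QF F} (h : φ.Nondeg) : ND φ.q := by
  intro x hx
  exact h.1 x fun y => hx y

lemma ND_smul {F : Type} [Field F] {φ : QF F} {c : F} (hc : c ≠ 0) (h : ND (φ.smul c).q) : ND φ.q := by
  intro x hx
  refine h x fun y => ?_
  have hy : ∀ y : φ.V, QuadraticMap.polar (fun x => c * φ.q x) x y = 0 := by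
    intro y
    have := hx y
    simp only [QuadraticMap.polar] at this ⊢
    linear_combination c * this
  exact hy y

variable {F : Type} [Field F] [NeZero (2 : F)] [Invertible (2 : F)]

lemma pfister_cls0 (l : List Fˣ) : HasCls (QF.pfister (l.map fun a : Fˣ => (a : F))) (pf l) := by
  induction l with
  | nil => exact HasCls.one
  | cons a l ih =>
    show HasCls ((QF.bin (a : F)).tmul (QF.pfister (l.map fun a : Fˣ => (a : F)))) _
    rw [pf_cons]; exact ih.tmul_bin a.ne_zero

lemma pfister_cls {n : ℕ} (l : Fin n → F) (h : ND (QF.pfister (List.ofFn l)).q) :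
    ∃ u : List Fˣ, u.length = n ∧ HasCls (QF.pfister (List.ofFn l)) (pf u) := by
  have h0 := pfister_ne_zero _ h
  have h1 : ∀ i, l i ≠ 0 := fun i => h0 _ (by simp)
  refine ⟨List.ofFn fun i => Units.mk0 (l i) (h1 i), by simp, ?_⟩
  have := pfister_cls0 (List.ofFn fun i => Units.mk0 (l i) (h1 i))
  rw [List.map_ofFn] at this
  exact this

lemma sum_cls {n r : ℕ} (c : Fin r → F) (l : Fin r → Fin n → F) (hc : ∀ i, c i ≠ 0) (s : List (Fin r))
    (h : ND (QF.sumList (s.map fun i => QF.smul (c i) (QF.pfister (List.ofFn (l i))))).q) :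
    ∃ x ∈ IP n F, HasCls (QF.sumList (s.map fun i => QF.smul (c i) (QF.pfister (List.ofFn (l i))))) x := by
  induction s with
  | nil => exact ⟨0, zero_mem _, HasCls.zero⟩
  | cons i s ih =>
    obtain ⟨h1, h2⟩ := ND.of_prod h
    obtain ⟨x, hx, hx'⟩ := ih h2
    obtain ⟨u, hu, hu'⟩ := pfister_cls (l i) (ND_smul (hc i) h1)
    exact ⟨br (c i) * pf u + x, add_mem (AddSubgroup.subset_closure ⟨Units.mk0 _ (hc i), u, hu, rfl⟩) hx,
      (hu'.smul (hc i)).add hx'⟩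

lemma InFund_IP {n : ℕ} {φ : QF F} {x : W F} (hx : HasCls φ x) (h : QF.InFundPow n φ) : x ∈ IP n F := by
  obtain ⟨r, c, l, hc, h⟩ := h
  have h0 := HasCls.of_hyp h
  have h1 := (ND.of_prod h0.nd).2
  have hm : (-1 : F) ≠ 0 := neg_ne_zero.2 one_ne_zero
  obtain ⟨y, hy, hy'⟩ := sum_cls c l hc _ (ND_smul hm h1)
  have h2 := (hx.add (hy'.smul hm)).uniq h0
  rw [br_neg, br_one] at h2
  have : x = y := by linear_combination h2
  exact this ▸ hy

lemma pf_InFund {n : ℕ} (l : List Fˣ) (hl : l.length = n) :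
    QF.InFundPow n (QF.pfister (l.map fun a : Fˣ => (a : F))) := by
  subst hl
  refine ⟨1, fun _ => 1, fun _ i => (l.get i : Fˣ), fun _ => one_ne_zero, ?_⟩
  have e : List.ofFn (fun i => ((l.get i : Fˣ) : F)) = l.map fun a : Fˣ => (a : F) := by
    apply List.ext_get <;> simp
  apply HasCls.isHyp
  have hm : (-1 : F) ≠ 0 := neg_ne_zero.2 one_ne_zero
  have h := pfister_cls0 l
  have h2 := h.add ((((h.smul (one_ne_zero (α := F))).add HasCls.zero)).smul hm)
  have h3 : pf l + br (-1 : F) * (br (1 : F) * pf l + 0) = 0 := by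
    rw [br_neg, br_one]; ring
  rw [h3] at h2
  rw [← e] at h2 ⊢
  exact h2

end concl

lemma PP_of (K : Type) [Field K] (n : ℕ)
    (hI : ∀ (L : FieldExt K) [Invertible (2 : L.carrier)],
      (∃ i : L.carrier, i * i = -1 ∧ Algebra.adjoin K {i} = ⊤) →
      ∀ ψ : QF L.carrier, ψ.Nondeg → QF.InFundPow (n + 1) ψ → ψ.IsHyperbolic) : PP n K := by
  intro E _ _ f i hi hs l hl
  let _ : Algebra K E := f.toAlgebra
  let _ : Invertible (2 : E) := invertibleOfNonzero two_ne_zero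
  have hc := pfister_cls0 l
  have h := hI ⟨E⟩ ⟨i, by rw [← pow_two]; exact hi, ?_⟩ (QF.pfister (l.map fun a : Eˣ => (a : E))) hc.nd.nondeg
    (pf_InFund l hl)
  · exact hc.uniq (HasCls.of_hyp h)
  · refine eq_top_iff.2 fun e _ => ?_
    obtain ⟨x, y, rfl⟩ := hs e
    exact add_mem (Subalgebra.algebraMap_mem _ x)
      (mul_mem (Subalgebra.algebraMap_mem _ y) (Algebra.subset_adjoin rfl))

end WT

/-- if `I^{n+1}K(√-1) = 0` and `φ ∈ IⁿK` is torsion, then every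
`a ∈ K×` is a norm from a finite 2-extension splitting `φ`; so `Hyp₂(φ) = K×`. -/
theorem stmt7 (K : Type) [Field K] [Invertible (2 : K)] (n : ℕ) (hn : 1 ≤ n)
    (hI : ∀ (L : FieldExt K) [Invertible (2 : L.carrier)],
      (∃ i : L.carrier, i * i = -1 ∧ Algebra.adjoin K {i} = ⊤) →
      ∀ ψ : QF L.carrier, ψ.Nondeg → QF.InFundPow (n + 1) ψ → ψ.IsHyperbolic)
    (φ : QF K) (hφ : φ.Nondeg)
    (htor : ∃ m : ℕ, 0 < m ∧ QF.IsHyperbolic (QF.nsmul m φ))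
    (hIn : QF.InFundPow n φ) :
    (∀ a : K, a ≠ 0 → ∃ L : FieldExt K, IsTwoExtension K L.carrier ∧
      QF.IsHyperbolic (QF.baseChange L.carrier φ) ∧ a ∈ normSet K L.carrier) ∧
    (QF.Hyp2 φ : Set K) = {a : K | a ≠ 0} := by
  have hz : NeZero (2 : K) := ⟨Invertible.ne_zero 2⟩
  have hP := WT.PP_of K n hI
  obtain ⟨m, hm⟩ := WT.exists_dq φ (WT.ND_of_nondeg hφ)
  have hc : WT.HasCls φ (WT.cl m) := ⟨m, hm, rfl⟩
  have hIP := WT.InFund_IP hc hIn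
  have hT : WT.Tor (WT.cl m) := by
    obtain ⟨k, hk, h⟩ := htor
    exact ⟨k, hk, (hc.nsmul k).uniq (WT.HasCls.of_hyp h)⟩
  have main : ∀ a : K, a ≠ 0 → ∃ L : FieldExt K, IsTwoExtension K L.carrier ∧
      QF.IsHyperbolic (QF.baseChange L.carrier φ) ∧ a ∈ normSet K L.carrier := by
    intro a ha
    obtain ⟨L, h1, h2, h3⟩ := WT.splitting hn m.length K m a rfl hP hIP hT ha
    refine ⟨L, h1, ?_, h3⟩
    have : NeZero (2 : L.carrier) := WT.neZero_emb (algebraMap K L.carrier)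
    have h4 : WT.HasCls (QF.baseChange L.carrier φ) (WT.wmap (algebraMap K L.carrier) (WT.cl m)) := hc.baseChange
    rw [h2] at h4
    exact h4.isHyp
  refine ⟨main, ?_⟩
  ext a
  constructor
  · intro h
    have h' : a ∈ Submonoid.closure (QF.hypSet2 φ) := h
    show a ≠ 0
    induction h' using Submonoid.closure_induction with
    | mem x hx =>
      obtain ⟨L, h1, h2, w, hw, rfl⟩ := hx
      have := h1.1
      exact Algebra.norm_ne_zero_iff.2 hw
    | one => exact one_ne_zero
    | mul x y hx' hy' hx hy => exact mul_ne_zero (hx hx') (hy hy')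
  · intro h
    exact Submonoid.subset_closure (main a h)
end

section
/- Let (K, v) be a henselian valued field with residue characteristic different from 2, φ a nondegenerate quadratic form over K, and t ∈ G(φ) with v(t) ∉ 2·v(K×). Then φ becomes hyperbolic over K(√-t). -/
open scoped TensorProduct

open QuadraticMap in
theorem aux_refl {K V : Type} [Field K] [AddCommGroup V] [Module K V]
    (q : QuadraticForm K V) (w : V) (hw : q w ≠ 0) :
    ∃ τ : V →ₗ[K] V, (∀ z, q (τ z) = q z) ∧ ∀ z, τ z = z - (polar q z w / q w) • w := by
  refine ⟨LinearMap.id - ((q w)⁻¹ • (polarBilin q).flip w).smulRight w, ?_, ?_⟩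
  · intro z
    have h : (LinearMap.id - ((q w)⁻¹ • (polarBilin q).flip w).smulRight w : V →ₗ[K] V) z
        = z + (-(polar q z w / q w)) • w := by
      simp [div_eq_inv_mul, sub_eq_add_neg]
    rw [h, QuadraticMap.map_add q, QuadraticMap.map_smul, polar_smul_right]
    simp only [smul_eq_mul]
    field_simp
    ring
  · intro z
    simp [div_eq_inv_mul]

open QuadraticMap in
/-- A single reflection moves `u` to `v` or `-v`, and fixes everything orthogonal to both. -/
theorem aux_move {K V : Type} [Field K] [AddCommGroup V] [Module K V] (h2 : (2 : K) ≠ 0)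
    (q : QuadraticForm K V) (u v : V) (huv : q u = q v) (hu : q u ≠ 0) :
    ∃ τ : V →ₗ[K] V, (∀ z, q (τ z) = q z) ∧ (∃ e : K, e ≠ 0 ∧ τ u = e • v) ∧
      ∀ z, polar q z u = 0 → polar q z v = 0 → τ z = z := by
  have hadd : q (u + v) = 2 * q u + polar q u v := by
    rw [QuadraticMap.map_add q, ← huv]; ring
  have hsub : q (u - v) = 2 * q u - polar q u v := by
    rw [sub_eq_add_neg, QuadraticMap.map_add q, polar_neg_right, QuadraticMap.map_neg, ← huv]; ring
  have hself : polar q u u = 2 * q u := by rw [polar_self]; simp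
  by_cases h : q (u - v) = 0
  · have hp : q (u + v) ≠ 0 := by
      intro h'
      have : 2 * (2 * q u) = 0 := by linear_combination h - hsub + h' - hadd
      simp [h2, hu] at this
    obtain ⟨τ, h1, h3⟩ := aux_refl q (u + v) hp
    refine ⟨τ, h1, ⟨-1, by simp, ?_⟩, ?_⟩
    · rw [h3, polar_add_right, hself, ← hadd, div_self hp]
      module
    · intro z hz hz'
      rw [h3, polar_add_right, hz, hz']; simp
  · obtain ⟨τ, h1, h3⟩ := aux_refl q (u - v) h
    refine ⟨τ, h1, ⟨1, by simp, ?_⟩, ?_⟩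
    · rw [h3, polar_sub_right, hself, ← hsub, div_self h]
      module
    · intro z hz hz'
      rw [h3, polar_sub_right, hz, hz']; simp

open QuadraticMap in
theorem aux_polar_sim {K V : Type} [Field K] [AddCommGroup V] [Module K V]
    (q : QuadraticForm K V) (t : K) (f : V →ₗ[K] V) (hf : ∀ z, q (f z) = t * q z) (a b : V) :
    polar q (f a) (f b) = t * polar q a b := by
  simp only [polar, ← _root_.map_add, hf]
  ring

open QuadraticMap in
theorem aux_cancel {K V : Type} [Field K] [AddCommGroup V] [Module K V] (h2 : (2 : K) ≠ 0)
    (q : QuadraticForm K V) (t : K) (ht : t ≠ 0) (f : V →ₗ[K] V) (hf : ∀ z, q (f z) = t * q z)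
    (x y u w : V) (hx : q x ≠ 0) (hy : q y ≠ 0) (hxy : polar q x y = 0)
    (huw : polar q u w = 0) (hu : q u = t * q x) (hw : q w = t * q y) :
    ∃ g : V →ₗ[K] V, (∀ z, q (g z) = t * q z) ∧ (∃ e : K, e ≠ 0 ∧ g x = e • u) ∧
      ∃ e : K, e ≠ 0 ∧ g y = e • w := by
  obtain ⟨τ, h1, ⟨e, he, h3⟩, -⟩ := aux_move h2 q (f x) u (by rw [hf, hu])
    (by rw [hf]; exact mul_ne_zero ht hx)
  have hg1 : ∀ z, q ((τ ∘ₗ f) z) = t * q z := fun z => by simp [h1, hf]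
  have hp := aux_polar_sim q t _ hg1 x y
  rw [hxy, LinearMap.comp_apply, h3, polar_smul_left, mul_zero, smul_eq_mul] at hp
  have hp' := (mul_eq_zero.1 hp).resolve_left he
  obtain ⟨σ, h4, h5, h6⟩ := aux_move h2 q ((τ ∘ₗ f) y) w (by rw [hg1, hw])
    (by rw [hg1]; exact mul_ne_zero ht hy)
  refine ⟨σ ∘ₗ (τ ∘ₗ f), fun z => by rw [LinearMap.comp_apply, h4, hg1], ⟨e, he, ?_⟩, h5⟩
  rw [LinearMap.comp_apply, LinearMap.comp_apply, h3, _root_.map_smul, h6 u hp' huw]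

/-- the orthogonal complement of two vectors -/
noncomputable def auxPerp {K V : Type} [Field K] [AddCommGroup V] [Module K V]
    (q : QuadraticForm K V) (x y : V) : Submodule K V :=
  LinearMap.ker ((QuadraticMap.polarBilin q).flip x) ⊓
    LinearMap.ker ((QuadraticMap.polarBilin q).flip y)

theorem mem_auxPerp {K V : Type} [Field K] [AddCommGroup V] [Module K V]
    (q : QuadraticForm K V) (x y z : V) : z ∈ auxPerp q x y ↔
      QuadraticMap.polar q z x = 0 ∧ QuadraticMap.polar q z y = 0 := by
  simp [auxPerp]

open QuadraticMap in
theorem aux_split {K V : Type} [Field K] [AddCommGroup V] [Module K V] (h2 : (2 : K) ≠ 0)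
    (q : QuadraticForm K V)
    (x y : V) (hx : q x ≠ 0) (hy : q y ≠ 0) (hxy : polar q x y = 0) :
    ∃ E : V ≃ₗ[K] (Fin 2 → K) × auxPerp q x y,
      ∀ v, q v = q x * (E v).1 0 ^ 2 + q y * (E v).1 1 ^ 2 + q (E v).2 := by
  have hxx : polar q x x = 2 * q x := by rw [polar_self]; simp
  have hyy : polar q y y = 2 * q y := by rw [polar_self]; simp
  have hyx : polar q y x = 0 := by rw [polar_comm, hxy]
  have h2x : polar q x x ≠ 0 := by rw [hxx]; exact mul_ne_zero h2 hx
  have h2y : polar q y y ≠ 0 := by rw [hyy]; exact mul_ne_zero h2 hy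
  let F : ((Fin 2 → K) × auxPerp q x y) →ₗ[K] V :=
    LinearMap.coprod
      ((LinearMap.proj 0 : (Fin 2 → K) →ₗ[K] K).smulRight x +
        (LinearMap.proj 1 : (Fin 2 → K) →ₗ[K] K).smulRight y) (Submodule.subtype _)
  have hF : ∀ p, F p = p.1 0 • x + p.1 1 • y + p.2 := fun p => by simp [F]
  have hbij : Function.Bijective F := by
    constructor
    · rw [injective_iff_map_eq_zero]
      intro p hp
      rw [hF] at hp
      obtain ⟨m1, m2⟩ := (mem_auxPerp q x y p.2).1 p.2.2
      have e1 : polar q (p.1 0 • x + p.1 1 • y + p.2) x = 0 := by rw [hp]; simp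
      have e2 : polar q (p.1 0 • x + p.1 1 • y + p.2) y = 0 := by rw [hp]; simp
      rw [polar_add_left, polar_add_left, polar_smul_left, polar_smul_left, hyx, m1] at e1
      rw [polar_add_left, polar_add_left, polar_smul_left, polar_smul_left, hxy, m2] at e2
      simp [h2x, -polar_self] at e1
      simp [h2y, -polar_self] at e2
      rw [e1, e2] at hp
      ext i
      · fin_cases i
        · exact e1
        · exact e2
      · simpa using hp
    · intro v
      refine ⟨(![polar q v x / polar q x x, polar q v y / polar q y y],
        ⟨v - (polar q v x / polar q x x) • x - (polar q v y / polar q y y) • y, ?_⟩), ?_⟩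
      · rw [mem_auxPerp]
        constructor
        · rw [polar_sub_left, polar_sub_left, polar_smul_left, polar_smul_left, hyx, smul_eq_mul,
            div_mul_cancel₀ _ h2x]; simp
        · rw [polar_sub_left, polar_sub_left, polar_smul_left, polar_smul_left, hxy, smul_eq_mul,
            smul_eq_mul, div_mul_cancel₀ _ h2y]; simp
      · rw [hF]; simp
  let E := LinearEquiv.ofBijective F hbij
  refine ⟨E.symm, fun v => ?_⟩
  obtain ⟨p, rfl⟩ := E.surjective v
  rw [LinearEquiv.symm_apply_apply]
  obtain ⟨m1, m2⟩ := (mem_auxPerp q x y p.2).1 p.2.2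
  change q (F p) = _
  rw [hF, QuadraticMap.map_add q, QuadraticMap.map_add q, polar_add_left, polar_smul_left,
    polar_smul_left, polar_smul_left, polar_smul_right, hxy, polar_comm q x, polar_comm q y, m1, m2,
    QuadraticMap.map_smul, QuadraticMap.map_smul]
  simp only [smul_eq_mul]
  ring

/-- Over `L`, `a⟨1, -d²⟩` is a hyperbolic plane. -/
theorem aux_plane {L : Type} [Field L] (h2 : (2 : L) ≠ 0) (a d : L) (ha : a ≠ 0) (hd : d ≠ 0) :
    ∃ T : (Fin 2 → L) ≃ₗ[L] (Fin 2 → L),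
      ∀ z, (QuadraticMap.weightedSumSquares L ![(1 : L), -1]) (T z) = a * z 0 ^ 2 + (-(d ^ 2) * a) * z 1 ^ 2 := by
  let A : (Fin 2 → L) →ₗ[L] (Fin 2 → L) := Matrix.mulVecLin
    !![(a + 1) / 2, d * (1 - a) / 2; (a - 1) / 2, -(d * (a + 1)) / 2]
  let B : (Fin 2 → L) →ₗ[L] (Fin 2 → L) := Matrix.mulVecLin
    !![(a⁻¹ + 1) / 2, (a⁻¹ - 1) / 2; (1 - a⁻¹) / (2 * d), (-1 - a⁻¹) / (2 * d)]
  refine ⟨LinearEquiv.ofLinearMap A B ?_ ?_, fun z => ?_⟩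
  · apply LinearMap.ext; intro z; ext i
    fin_cases i
    · simp [A, B, Matrix.mulVec, dotProduct, Fin.sum_univ_two]; field_simp; ring
    · simp [A, B, Matrix.mulVec, dotProduct, Fin.sum_univ_two]; field_simp; ring
  · apply LinearMap.ext; intro z; ext i
    fin_cases i
    · simp [A, B, Matrix.mulVec, dotProduct, Fin.sum_univ_two]; field_simp; ring
    · simp [A, B, Matrix.mulVec, dotProduct, Fin.sum_univ_two]; field_simp; ring
  · change (QuadraticMap.weightedSumSquares L ![(1 : L), -1]) (A z) = _
    simp [A, QuadraticMap.weightedSumSquares_apply, Matrix.mulVec, dotProduct, Fin.sum_univ_two]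
    field_simp; ring

open QuadraticMap in
theorem aux_step {K : Type} [Field K] [Invertible (2 : K)] (L : Type) [Field L] [Algebra K L]
    {V : Type} [AddCommGroup V] [Module K V] [FiniteDimensional K V] (q : QuadraticForm K V)
    (x y : V) (hx : q x ≠ 0) (hy : q y ≠ 0) (hxy : polar q x y = 0) (d : L)
    (hd : algebraMap K L (q y) = -(d ^ 2) * algebraMap K L (q x))
    (h : QF.IsHyperbolic (QF.baseChange L
      { V := auxPerp q x y, q := q.comp (Submodule.subtype _) : QF K })) :
    QF.IsHyperbolic (QF.baseChange L { V := V, q := q : QF K }) := by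
  have h2 : (2 : K) ≠ 0 := Invertible.ne_zero 2
  have h2L : (2 : L) ≠ 0 := by
    have := (_root_.map_ne_zero (algebraMap K L)).2 h2
    rwa [map_ofNat] at this
  obtain ⟨E, hE⟩ := aux_split h2 q x y hx hy hxy
  have hx' : algebraMap K L (q x) ≠ 0 := (_root_.map_ne_zero _).2 hx
  have hy' : algebraMap K L (q y) ≠ 0 := (_root_.map_ne_zero _).2 hy
  have hd0 : d ≠ 0 := by rintro rfl; simp [hy] at hd
  obtain ⟨T, hT⟩ := aux_plane h2L (algebraMap K L (q x)) d hx' hd0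
  obtain ⟨m, ⟨e⟩⟩ := h
  refine ⟨m + 1, ?_⟩
  let Φ : L ⊗[K] V ≃ₗ[L] (Fin 2 → L) × (L ⊗[K] auxPerp q x y) :=
    (E.baseChange K L V _) ≪≫ₗ TensorProduct.prodRight K L L (Fin 2 → K) (auxPerp q x y) ≪≫ₗ
      ((TensorProduct.piScalarRight K L L (Fin 2) ≪≫ₗ T).prodCongr (LinearEquiv.refl L _))
  have key : ((QuadraticMap.weightedSumSquares L ![(1 : L), -1]).prod (QuadraticForm.baseChange L
      (q.comp (Submodule.subtype (auxPerp q x y))))).comp Φ.toLinearMap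
        = QuadraticForm.baseChange L q := by
    apply baseChange_ext
    intro v
    have hΦ : Φ (1 ⊗ₜ v) =
        (T (fun i => algebraMap K L ((E v).1 i)), 1 ⊗ₜ (E v).2) := by
      simp [Φ, Algebra.algebraMap_eq_smul_one]
    rw [QuadraticMap.comp_apply, LinearEquiv.coe_coe, hΦ]
    rw [QuadraticMap.prod_apply, hT, QuadraticForm.baseChange_tmul, QuadraticForm.baseChange_tmul,
      hE v, ← hd]
    simp [Algebra.smul_def]
  have e1 : QuadraticMap.Equivalent (QuadraticForm.baseChange L q)
      ((QuadraticMap.weightedSumSquares L ![(1 : L), -1]).prod (QuadraticForm.baseChange L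
        (q.comp (Submodule.subtype (auxPerp q x y))))) :=
    ⟨⟨Φ, fun v => by rw [← key]; rfl⟩⟩
  exact e1.trans (QuadraticMap.Equivalent.prod (QuadraticMap.Equivalent.refl _) ⟨e⟩)

theorem aux_sqrt {K : Type} [Field K] (O : ValuationSubring K)
    [HenselianLocalRing O] (hres : (2 : IsLocalRing.ResidueField O) ≠ 0) (a : K)
    (ha : O.valuation a < 1) : ∃ s : K, s ^ 2 = 1 + a := by
  have haO : a ∈ O := (O.valuation_le_one_iff a).1 ha.le
  let a' : O := ⟨a, haO⟩
  have ham : a' ∈ IsLocalRing.maximalIdeal O := (O.valuation_lt_one_iff a').2 ha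
  have hu : IsUnit (2 : O) := by
    by_contra hn
    apply hres
    have := (IsLocalRing.residue_eq_zero_iff (2 : O)).2 ((IsLocalRing.mem_maximalIdeal _).2 hn)
    rwa [map_ofNat] at this
  obtain ⟨s, hs, -⟩ := HenselianLocalRing.is_henselian
    (Polynomial.X ^ 2 - Polynomial.C (1 + a')) (Polynomial.monic_X_pow_sub_C _ two_ne_zero) 1
    (by simpa using ham) (by simpa [one_add_one_eq_two] using hu)
  refine ⟨s, ?_⟩
  have h0 : s ^ 2 - (1 + a') = 0 := by simpa [Polynomial.IsRoot] using hs
  have := congrArg (fun z : O => (z : K)) (sub_eq_zero.1 h0)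
  simpa using this

open QuadraticMap in
/-- the anisotropic case: `φ` contains an orthogonal pair `x, y` with `q y = t q x`. -/
theorem aux_aniso {K V : Type} [Field K] [AddCommGroup V] [Module K V] (O : ValuationSubring K)
    [HenselianLocalRing O] (hres : (2 : IsLocalRing.ResidueField O) ≠ 0) (h2 : (2 : K) ≠ 0)
    (q : QuadraticForm K V) (t : K) (ht : t ≠ 0) (f : V →ₗ[K] V) (hf : ∀ z, q (f z) = t * q z)
    (hv : ¬ ∃ s : K, s ≠ 0 ∧ O.valuation t = (O.valuation s) ^ 2)
    (han : ∀ z, q z = 0 → z = 0) (x : V) (hx0 : x ≠ 0) :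
    ∃ y, polar q x y = 0 ∧ q y = t * q x := by
  have hc : q x ≠ 0 := fun h => hx0 (han x h)
  set c := q x with hcdef
  set p := polar q x (f x) with hp
  have hxx : polar q x x = 2 * c := by rw [polar_self]; simp [hcdef]
  have h4v : O.valuation 4 = 1 := by
    have hu : IsUnit (2 : O) := by
      by_contra hn
      apply hres
      have := (IsLocalRing.residue_eq_zero_iff (2 : O)).2 ((IsLocalRing.mem_maximalIdeal _).2 hn)
      rwa [map_ofNat] at this
    have := (O.valuation_eq_one_iff 2).1 hu
    have h22 : (4 : K) = ((2 : O) : K) * ((2 : O) : K) := by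
      change (4 : K) = 2 * 2; norm_num
    rw [h22, map_mul, this, one_mul]
  have h4 : (4 : K) ≠ 0 := by
    have : (4 : K) = 2 * 2 := by norm_num
    rw [this]; exact mul_ne_zero h2 h2
  have hlt : O.valuation (p ^ 2) < O.valuation (t * c ^ 2) := by
    by_contra hge
    have htc : t * c ^ 2 ≠ 0 := mul_ne_zero ht (pow_ne_zero 2 hc)
    have hp0 : p ≠ 0 := by
      intro h0
      apply hge
      rw [h0]
      have : (0 : O.ValueGroup) < O.valuation (t * c ^ 2) :=
        zero_lt_iff.2 ((_root_.map_ne_zero _).2 htc)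
      simpa using this
    have hlt2 : O.valuation (t * c ^ 2) < O.valuation (p ^ 2) := by
      refine lt_of_le_of_ne (not_lt.1 hge) ?_
      intro heq
      apply hv
      refine ⟨p / c, div_ne_zero hp0 hc, ?_⟩
      rw [← map_pow, div_pow, map_div₀, ← heq, ← map_div₀]
      congr 1
      field_simp
    obtain ⟨s, hs⟩ := aux_sqrt O hres (-(4 * (t * c ^ 2) / p ^ 2)) (by
      rw [Valuation.map_neg, map_div₀, map_mul, h4v, one_mul]
      rw [div_lt_one₀]
      · exact hlt2
      · exact zero_lt_iff.2 ((_root_.map_ne_zero _).2 (pow_ne_zero 2 hp0)))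
    have hs' : (p * s) ^ 2 = p ^ 2 - 4 * t * c ^ 2 := by
      rw [mul_pow, hs]; field_simp; ring
    set l := (-p + p * s) / (2 * c) with hl
    have hz : q (f x + l • x) = 0 := by
      rw [QuadraticMap.map_add q, hf, QuadraticMap.map_smul, polar_smul_right, polar_comm q, ← hp,
        ← hcdef, smul_eq_mul, smul_eq_mul]
      have : 4 * c * (t * c + l * l * c + l * p) = 0 := by
        have hl' : 2 * c * l = -p + p * s := by rw [hl]; field_simp
        linear_combination (2 * c * l + p + p * s) * hl' + hs'
      exact (mul_eq_zero.1 this).resolve_left (mul_ne_zero h4 hc)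
    have hfx : f x = (-l) • x := by
      have := han _ hz
      rw [neg_smul]; exact eq_neg_of_add_eq_zero_left this
    have h5 := hf x
    rw [hfx, QuadraticMap.map_smul, smul_eq_mul] at h5
    have h6 : -l * -l = t := mul_right_cancel₀ hc h5
    apply hv
    refine ⟨l, ?_, ?_⟩
    · rintro h0; rw [h0] at h6; apply ht; rw [← h6]; simp
    · rw [← h6]; simp [pow_two]
  have htc : t * c ^ 2 ≠ 0 := mul_ne_zero ht (pow_ne_zero 2 hc)
  have hlt1 : O.valuation (-(p ^ 2 / (4 * (t * c ^ 2)))) < 1 := by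
    rw [Valuation.map_neg, map_div₀, map_mul, h4v, one_mul, div_lt_one₀]
    · exact hlt
    · exact zero_lt_iff.2 ((_root_.map_ne_zero _).2 htc)
  obtain ⟨s, hs⟩ := aux_sqrt O hres _ hlt1
  have hs0 : s ≠ 0 := by
    rintro rfl
    have : (-(p ^ 2 / (4 * (t * c ^ 2)))) = -1 := by linear_combination -hs
    rw [this] at hlt1
    simp at hlt1
  refine ⟨s⁻¹ • (f x - (p / (2 * c)) • x), ?_, ?_⟩
  · rw [polar_smul_right, polar_sub_right, polar_smul_right, hxx, ← hp, smul_eq_mul,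
      smul_eq_mul, div_mul_cancel₀ _ (mul_ne_zero h2 hc)]
    simp
  · rw [QuadraticMap.map_smul, sub_eq_add_neg, QuadraticMap.map_add q, hf, QuadraticMap.map_neg,
      QuadraticMap.map_smul, polar_neg_right, polar_smul_right, polar_comm q, ← hp, ← hcdef]
    simp only [smul_eq_mul]
    have hs'' : 4 * t * c ^ 2 * s ^ 2 = 4 * t * c ^ 2 - p ^ 2 := by
      rw [hs]; field_simp; ring
    field_simp
    linear_combination -hs''

open QuadraticMap in
theorem aux_main {K : Type} [Field K] [Invertible (2 : K)] (O : ValuationSubring K)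
    [HenselianLocalRing O] (hres : (2 : IsLocalRing.ResidueField O) ≠ 0)
    (t : K) (ht : t ≠ 0)
    (hv : ¬ ∃ s : K, s ≠ 0 ∧ O.valuation t = (O.valuation s) ^ 2)
    (L : Type) [Field L] [Algebra K L]
    (r : L) (hr : r ^ 2 = algebraMap K L (-t)) (n : ℕ) :
    ∀ (V : Type) [AddCommGroup V] [Module K V] [FiniteDimensional K V] (q : QuadraticForm K V),
      Module.finrank K V = n → (∀ v, (∀ w, polar q v w = 0) → v = 0) →
      ∀ f : V →ₗ[K] V, (∀ z, q (f z) = t * q z) →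
      QF.IsHyperbolic (QF.baseChange L { V := V, q := q : QF K }) := by
  have h2 : (2 : K) ≠ 0 := Invertible.ne_zero 2
  induction n using Nat.strong_induction_on with
  | _ n ih =>
  intro V _ _ _ q hn hnd f hf
  by_cases hV : Subsingleton V
  · refine ⟨0, ?_⟩
    have : Subsingleton (L ⊗[K] V) := by
      refine ⟨fun a b => ?_⟩
      have h0 : ∀ a : L ⊗[K] V, a = 0 := fun a => by
        induction a using TensorProduct.induction_on with
        | zero => rfl
        | tmul a v => rw [Subsingleton.elim v 0, TensorProduct.tmul_zero]
        | add a b ha hb => rw [ha, hb, add_zero]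
      rw [h0 a, h0 b]
    refine ⟨⟨(LinearEquiv.ofSubsingleton (L ⊗[K] V) (Fin 0 → L)), fun a => ?_⟩⟩
    have : a = (0 : L ⊗[K] V) := Subsingleton.elim (α := L ⊗[K] V) _ _
    subst this
    erw [_root_.map_zero]
  rw [not_subsingleton_iff_nontrivial] at hV
  -- it suffices to find a good plane
  suffices H : ∃ x y u w : V, q x ≠ 0 ∧ q y ≠ 0 ∧ polar q x y = 0 ∧ polar q u w = 0 ∧
      q u = t * q x ∧ q w = t * q y ∧
      (∀ z, polar q z u = 0 → polar q z w = 0 → polar q z x = 0 ∧ polar q z y = 0) ∧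
      ∃ d : L, algebraMap K L (q y) = -(d ^ 2) * algebraMap K L (q x) by
    obtain ⟨x, y, u, w, hx, hy, hxy, huw, hu, hw, hz, d, hd⟩ := H
    obtain ⟨g, hg, ⟨e₁, he₁, hgx⟩, ⟨e₂, he₂, hgy⟩⟩ :=
      aux_cancel h2 q t ht f hf x y u w hx hy hxy huw hu hw
    have hmap : ∀ z ∈ auxPerp q x y, g z ∈ auxPerp q x y := by
      intro z hzm
      rw [mem_auxPerp] at hzm ⊢
      have p1 := aux_polar_sim q t g hg z x
      have p2 := aux_polar_sim q t g hg z y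
      rw [hgx, hzm.1, polar_smul_right, mul_zero, smul_eq_mul] at p1
      rw [hgy, hzm.2, polar_smul_right, mul_zero, smul_eq_mul] at p2
      exact hz _ ((mul_eq_zero.1 p1).resolve_left he₁) ((mul_eq_zero.1 p2).resolve_left he₂)
    apply aux_step L q x y hx hy hxy d hd
    refine ih (Module.finrank K (auxPerp q x y)) ?_ (auxPerp q x y) _ rfl ?_
      (g.restrict hmap) ?_
    · rw [← hn]
      apply Submodule.finrank_lt
      intro htop
      have : x ∈ auxPerp q x y := by rw [htop]; trivial
      have := ((mem_auxPerp q x y x).1 this).1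
      rw [polar_self] at this
      simp [h2, hx] at this
    · rintro ⟨v, hvm⟩ hvw
      obtain ⟨E, hE⟩ := aux_split h2 q x y hx hy hxy
      obtain ⟨m1, m2⟩ := (mem_auxPerp q x y v).1 hvm
      have : v = 0 := by
        apply hnd
        intro b
        have hxx : polar q x x = 2 * q x := by rw [polar_self]; simp
        have hyy : polar q y y = 2 * q y := by rw [polar_self]; simp
        have hyx : polar q y x = 0 := by rw [polar_comm, hxy]
        have h2x : polar q x x ≠ 0 := by rw [hxx]; exact mul_ne_zero h2 hx
        have h2y : polar q y y ≠ 0 := by rw [hyy]; exact mul_ne_zero h2 hy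
        have hb : b - (polar q b x / polar q x x) • x - (polar q b y / polar q y y) • y
            ∈ auxPerp q x y := by
          rw [mem_auxPerp]
          constructor
          · rw [polar_sub_left, polar_sub_left, polar_smul_left, polar_smul_left, hyx, smul_eq_mul,
              div_mul_cancel₀ _ h2x]; simp
          · rw [polar_sub_left, polar_sub_left, polar_smul_left, polar_smul_left, hxy, smul_eq_mul,
              smul_eq_mul, div_mul_cancel₀ _ h2y]; simp
        have h7 := hvw ⟨_, hb⟩
        change polar q v _ = 0 at h7
        rw [polar_sub_right, polar_sub_right, polar_smul_right, polar_smul_right, m1, m2] at h7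
        simpa using h7
      exact Subtype.ext this
    · rintro ⟨z, hzm⟩
      exact hg z
  by_cases han : ∀ z, q z = 0 → z = 0
  · obtain ⟨x, hx0⟩ := exists_ne (0 : V)
    obtain ⟨y, hxy, hy⟩ := aux_aniso O hres h2 q t ht f hf hv han x hx0
    have hx : q x ≠ 0 := fun h => hx0 (han x h)
    refine ⟨x, y, y, t • x, hx, ?_, hxy, ?_, hy, ?_, ?_, r, ?_⟩
    · rw [hy]; exact mul_ne_zero ht hx
    · rw [polar_smul_right, polar_comm, hxy, smul_zero]
    · rw [QuadraticMap.map_smul, hy, smul_eq_mul]; ring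
    · intro z h1 h3
      rw [polar_smul_right, smul_eq_mul] at h3
      exact ⟨(mul_eq_zero.1 h3).resolve_left ht, h1⟩
    · rw [hr, hy]; simp
  · push Not at han
    obtain ⟨v, hqv, hv0⟩ := han
    obtain ⟨w, hw⟩ : ∃ w, polar q v w ≠ 0 := by
      by_contra hcon
      push Not at hcon
      exact hv0 (hnd v hcon)
    obtain ⟨w1, hw1⟩ : ∃ w, polar q v w = 1 :=
      ⟨(polar q v w)⁻¹ • w, by rw [polar_smul_right, smul_eq_mul, inv_mul_cancel₀ hw]⟩
    obtain ⟨w2, hw2, hqw2⟩ : ∃ w, polar q v w = 1 ∧ q w = 0 := by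
      refine ⟨w1 + (-q w1) • v, ?_, ?_⟩
      · rw [polar_add_right, polar_smul_right, polar_self, hqv, hw1]; simp
      · rw [QuadraticMap.map_add q, QuadraticMap.map_smul, polar_smul_right, polar_comm, hw1, hqv]
        simp
    have hq : ∀ a b : K, q (a • v + b • w2) = a * b := by
      intro a b
      rw [QuadraticMap.map_add q, QuadraticMap.map_smul, QuadraticMap.map_smul, polar_smul_left,
        polar_smul_right, hw2, hqv, hqw2]
      simp
    have hpol : ∀ a b a' b' : K, polar q (a • v + b • w2) (a' • v + b' • w2) = a * b' + b * a' := by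
      intro a b a' b'
      have : (a • v + b • w2) + (a' • v + b' • w2) = (a + a') • v + (b + b') • w2 := by module
      rw [polar, this, hq, hq, hq]; ring
    refine ⟨(1 : K) • v + (1 : K) • w2, (1 : K) • v + (-1 : K) • w2, t • v + (1 : K) • w2,
      t • v + (-1 : K) • w2, ?_, ?_, ?_, ?_, ?_, ?_, ?_, 1, ?_⟩
    · rw [hq]; simp
    · rw [hq]; simp
    · rw [hpol]; simp
    · rw [hpol]; simp
    · rw [hq, hq]; simp
    · rw [hq, hq]; simp
    · intro z h1 h3
      simp only [polar_add_right, polar_smul_right, smul_eq_mul] at h1 h3 ⊢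
      have e1 : 2 * (t * polar q z v) = 0 := by linear_combination h1 + h3
      have e2 : 2 * polar q z w2 = 0 := by linear_combination h1 - h3
      have e1' : polar q z v = 0 := by simpa [h2, ht] using e1
      have e2' : polar q z w2 = 0 := by simpa [h2] using e2
      rw [e1', e2']; simp
    · rw [hq, hq]; simp

/-- over a henselian valued field with residue characteristic ≠ 2,
a similarity factor `t` with `v(t) ∉ 2vK` makes `φ` hyperbolic over `K(√-t)`. -/
theorem stmt10 (K : Type) [Field K] [Invertible (2 : K)] (O : ValuationSubring K)
    [HenselianLocalRing O] (hres : (2 : IsLocalRing.ResidueField O) ≠ 0)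
    (φ : QF K) (hφ : φ.Nondeg) (t : K) (ht : t ∈ QF.G φ)
    (hv : ¬ ∃ s : K, s ≠ 0 ∧ O.valuation t = (O.valuation s) ^ 2)
    (L : Type) [Field L] [Algebra K L]
    (r : L) (hr : r ^ 2 = algebraMap K L (-t)) (hgen : Algebra.adjoin K {r} = ⊤) :
    QF.IsHyperbolic (QF.baseChange L φ) := by
  obtain ⟨ht0, ⟨e⟩⟩ := ht
  refine aux_main O hres t ht0 hv L r hr _ φ.V φ.q rfl ?_ e.toLinearEquiv.toLinearMap ?_
  · intro v hvw
    exact hφ.1 v hvw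
  · intro z
    exact e.map_app z
end
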